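/- arXiv:2303.08497 — 6 statements merged into one kernel-verified Lean document; each statement's English description precedes it below -/
import Mathlib

section
/- Let R be an integral domain with quotient field K and let f_1, …, f_n ∈ R[x_1, …, x_n] be homogeneous polynomials. Assume that there is a monomial ordering on K[x_1, …, x_n] such that the leading coefficients of f_1, …, f_n are all units in R and the leading monomials of f_1, …, f_n are algebraically independent. Then R[f_1, …, f_n] = K[f_1, …, f_n] ∩ R[x_1, …, x_n] (as subrings of K[x_1, …, x_n]). -/
open MvPolynomial

/-- The exponent (multidegree) of the leading monomial of a multivariate polynomial `p`
with respect to a monomial order `m`: the largest element of the support of `p` in the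
order `m` (equal to `0` if `p = 0`). -/
noncomputable def leadingExp {n : ℕ} (m : MonomialOrder (Fin n)) {K : Type*} [CommSemiring K]
    (p : MvPolynomial (Fin n) K) : Fin n →₀ ℕ :=
  m.toSyn.symm (p.support.sup fun d => m.toSyn d)

/-- The exponent `∑ i, d i • a i`, that is, the exponent of the monomial obtained by substituting
the monomials with exponents `a i` for the variables in the monomial with exponent `d`. -/
noncomputable def substExp {σ τ : Type*} (a : σ → τ →₀ ℕ) (d : σ →₀ ℕ) : τ →₀ ℕ :=
  d.sum fun i k => k • a i

/-- If the monomials with exponents `a i` are algebraically independent, then substituting them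
for the variables is injective on exponents. -/
theorem substExp_injective {σ τ K : Type*} [CommRing K] [Nontrivial K] {a : σ → τ →₀ ℕ}
    (h : AlgebraicIndependent K fun i => (monomial (a i) (1 : K) : MvPolynomial τ K)) :
    Function.Injective (substExp a) := by
  have key (d : σ →₀ ℕ) :
      aeval (fun i => (monomial (a i) (1 : K) : MvPolynomial τ K)) (monomial d (1 : K)) =
        monomial (substExp a d) 1 := by
    rw [aeval_monomial, map_one, one_mul, substExp, monomial_finsupp_sum_index]
    simp [monomial_pow]
  intro d e hde
  refine monomial_left_injective (one_ne_zero (α := K)) (h ?_)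
  rw [key, key, hde]

theorem degree_finsuppProd_pow {σ τ K : Type*} [CommRing K] [IsDomain K] (m : MonomialOrder τ)
    {F : σ → MvPolynomial τ K} (hF : ∀ i, F i ≠ 0) (d : σ →₀ ℕ) :
    m.degree (d.prod fun i k => F i ^ k) = substExp (fun i => m.degree (F i)) d := by
  rw [Finsupp.prod, m.degree_prod fun i _ => pow_ne_zero _ (hF i)]
  simp only [m.degree_pow]
  rfl

theorem leadingCoeff_finsuppProd_pow {σ τ K : Type*} [CommRing K] [IsDomain K]
    (m : MonomialOrder τ) {F : σ → MvPolynomial τ K} (hF : ∀ i, F i ≠ 0) (d : σ →₀ ℕ) :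
    m.leadingCoeff (d.prod fun i k => F i ^ k) = d.prod fun i k => m.leadingCoeff (F i) ^ k := by
  rw [Finsupp.prod, m.leadingCoeff_prod_of_regular fun i _ =>
    IsRegular.of_ne_zero (m.leadingCoeff_ne_zero_iff.2 (pow_ne_zero _ (hF i)))]
  simp only [m.leadingCoeff_pow]
  rfl

/-- If the leading exponents of the `F i` are independent, then for every nonzero `P` the
coefficient of `P(F)` at some leading exponent of a term of `P` comes from this term only. -/
theorem exists_coeff_aeval_eq {σ τ K : Type*} [CommRing K] [IsDomain K] (m : MonomialOrder τ)
    {F : σ → MvPolynomial τ K} (hF : ∀ i, F i ≠ 0)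
    (hinj : Function.Injective (substExp fun i => m.degree (F i)))
    {P : MvPolynomial σ K} (hP : P ≠ 0) :
    ∃ d ∈ P.support, (aeval F P).coeff (substExp (fun i => m.degree (F i)) d) =
      P.coeff d * d.prod fun i k => m.leadingCoeff (F i) ^ k := by
  obtain ⟨d, hd, hmax⟩ := P.support.exists_max_image
    (fun d => m.toSyn (substExp (fun i => m.degree (F i)) d)) (support_nonempty.2 hP)
  refine ⟨d, hd, ?_⟩
  rw [aeval_def, eval₂_eq, coeff_sum, Finset.sum_eq_single_of_mem d hd]
  · rw [algebraMap_eq, coeff_C_mul, ← leadingCoeff_finsuppProd_pow m hF,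
      ← degree_finsuppProd_pow m hF]
    rfl
  · intro e he hed
    rw [algebraMap_eq, coeff_C_mul]
    refine mul_eq_zero_of_right _ (m.coeff_eq_zero_of_lt (f := e.prod fun i k => F i ^ k) ?_)
    rw [degree_finsuppProd_pow m hF]
    exact lt_of_le_of_ne (hmax e he) fun h => hed (hinj (m.toSyn.injective h))

/-- If the `f i` have unit leading coefficients and independent leading exponents over `K`, then
a polynomial `P` over `K` such that `P(f)` is defined over `R` is itself defined over `R`. -/
theorem mem_range_map_of_aeval_mem_range_map {σ τ R K : Type*} [CommRing R] [CommRing K]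
    [IsDomain K] (φ : R →+* K) (m : MonomialOrder τ) {f : σ → MvPolynomial τ R}
    (hunit : ∀ i, IsUnit ((f i).coeff (m.degree (map φ (f i)))))
    (hinj : Function.Injective (substExp fun i => m.degree (map φ (f i))))
    (P : MvPolynomial σ K) (hP : aeval (fun i => map φ (f i)) P ∈ (map φ).range) :
    P ∈ (map φ).range := by
  have hlc (i : σ) : m.leadingCoeff (map φ (f i)) = φ ((f i).coeff (m.degree (map φ (f i)))) :=
    coeff_map _ _ _
  have hF (i : σ) : map φ (f i) ≠ 0 := by
    rw [← m.leadingCoeff_ne_zero_iff, hlc]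
    exact ((hunit i).map φ).ne_zero
  classical
  induction hc : P.support.card using Nat.strong_induction_on generalizing P with
  | _ c ih =>
    obtain rfl | hP0 := eq_or_ne P 0
    · exact zero_mem _
    obtain ⟨d, hd, hcoeff⟩ := exists_coeff_aeval_eq m hF hinj hP0
    obtain ⟨q, hq⟩ := hP
    obtain ⟨u, hu⟩ : IsUnit (d.prod fun i k => (f i).coeff (m.degree (map φ (f i))) ^ k) := by
      rw [Finsupp.prod, IsUnit.prod_iff]
      exact fun i _ => (hunit i).pow _
    have hprod : (d.prod fun i k => m.leadingCoeff (map φ (f i)) ^ k) = φ u := by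
      simp only [hu, hlc, Finsupp.prod, map_prod, map_pow]
    rw [← hq, coeff_map, hprod] at hcoeff
    have hPd : P.coeff d = φ (q.coeff (substExp (fun i => m.degree (map φ (f i))) d) * ↑u⁻¹) := by
      rw [map_mul, hcoeff, mul_assoc, ← map_mul, Units.mul_inv, map_one, mul_one]
    have hterm : monomial d (P.coeff d) ∈ (map φ : MvPolynomial σ R →+* _).range := by
      rw [hPd, ← map_monomial]
      exact ⟨_, rfl⟩
    have hterm' : aeval (fun i => map φ (f i)) (monomial d (P.coeff d)) ∈
        (map φ : MvPolynomial τ R →+* _).range := by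
      rw [hPd, aeval_monomial, algebraMap_eq, ← map_C]
      exact mul_mem ⟨_, rfl⟩ (Subring.prod_mem _ fun i _ => pow_mem (RingHom.mem_range_self _ (f i)) _)
    rw [← sub_add_cancel P (monomial d (P.coeff d))]
    refine add_mem (ih _ ?_ _ ?_ rfl) hterm
    · rw [← hc]
      refine Finset.card_lt_card ⟨fun e he => ?_, fun h => ?_⟩
      · rw [mem_support_iff, coeff_sub, coeff_monomial] at he
        by_cases hde : d = e
        · simp [hde] at he
        · simpa [hde] using he
      · simpa [coeff_monomial] using h hd
    · rw [map_sub]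
      exact sub_mem ⟨q, hq⟩ hterm'

/-- let `R` be an integral domain with quotient field `K` and let
`f_1, …, f_n ∈ R[x_1, …, x_n]` be homogeneous.  Assume there is a monomial ordering on
`K[x_1, …, x_n]` such that the leading coefficients of the `f_i` are units in `R` and the
leading monomials of the `f_i` are algebraically independent.  Then
`R[f_1, …, f_n] = K[f_1, …, f_n] ∩ R[x_1, …, x_n]` as subsets of `K[x_1, …, x_n]`
(where `R[x_1, …, x_n]` is embedded in `K[x_1, …, x_n]` by mapping coefficients). -/
theorem adjoin_eq_adjoin_inter_polynomialRing
    {R K : Type*} [CommRing R] [IsDomain R] [Field K] [Algebra R K] [IsFractionRing R K]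
    {n : ℕ} (m : MonomialOrder (Fin n)) (f : Fin n → MvPolynomial (Fin n) R)
    (hhom : ∀ i, ∃ d : ℕ, (f i).IsHomogeneous d)
    (hunit : ∀ i, IsUnit ((f i).coeff (leadingExp m (map (algebraMap R K) (f i)))))
    (hind : AlgebraicIndependent K (fun i =>
      (monomial (leadingExp m (map (algebraMap R K) (f i))) (1 : K)
        : MvPolynomial (Fin n) K))) :
    (⇑(map (algebraMap R K) : MvPolynomial (Fin n) R →+* MvPolynomial (Fin n) K)) ''
        (Algebra.adjoin R (Set.range f) : Set (MvPolynomial (Fin n) R)) =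
      (Algebra.adjoin K (Set.range fun i => map (algebraMap R K) (f i))
          : Set (MvPolynomial (Fin n) K)) ∩
        Set.range (map (algebraMap R K) : MvPolynomial (Fin n) R →+* MvPolynomial (Fin n) K) := by
  have hinj := substExp_injective hind
  ext x
  rw [Algebra.adjoin_range_eq_range_aeval, Algebra.adjoin_range_eq_range_aeval]
  constructor
  · rintro ⟨_, ⟨p, rfl⟩, rfl⟩
    exact ⟨⟨map (algebraMap R K) p, (map_bind₁ _ f p).symm⟩, _, rfl⟩
  · rintro ⟨⟨P, rfl⟩, q, hq⟩
    obtain ⟨p, rfl⟩ := mem_range_map_of_aeval_mem_range_map (algebraMap R K) m hunit hinj P ⟨q, hq⟩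
    exact ⟨aeval f p, ⟨p, rfl⟩, map_bind₁ _ f p⟩
end

section
/- Let R be a Dedekind domain with quotient field K, let L = R^n, and let G ⊆ GL(L) be a finite subgroup such that K[L]^G is a polynomial ring generated by homogeneous elements f_1, …, f_n ∈ R[L]. Then the following are equivalent: (i) R[f_1, …, f_n] = R[L]^G; (ii) for every maximal ideal m ⊂ R one has R_m[f_1, …, f_n] = R_m[L]^G; (iii) for every maximal ideal m ⊂ R the residue classes of f_1, …, f_n in (R/m)[x_1, …, x_n] are algebraically independent over the field R/m. -/
set_option synthInstance.maxHeartbeats 1000000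
set_option maxHeartbeats 1000000

open MvPolynomial

/-- The algebra endomorphism of `A[x_1, …, x_n]` given by the linear substitution
`x_i ↦ ∑_j M_{i,j} x_j` for a matrix `M` over `A`. -/
noncomputable def matAct {A : Type*} [CommRing A] {n : ℕ} (M : Matrix (Fin n) (Fin n) A) :
    MvPolynomial (Fin n) A →ₐ[A] MvPolynomial (Fin n) A :=
  aeval fun i => ∑ j, C (M i j) * X j

/-- For a subgroup `G ⊆ GL_n(R)` and a base change `φ : R →+* A`, the invariant ring
`A[x_1, …, x_n]^G`: the subalgebra of polynomials fixed by the substitution action of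
every element of `G` (with matrix entries transported along `φ`). -/
noncomputable def invariantsOf {R A : Type*} [CommRing R] [CommRing A] {n : ℕ}
    (φ : R →+* A) (G : Subgroup (GL (Fin n) R)) : Subalgebra A (MvPolynomial (Fin n) A) :=
  ⨅ g ∈ G, AlgHom.equalizer
    (matAct (((g : GL (Fin n) R) : Matrix (Fin n) (Fin n) R).map φ)) (AlgHom.id A _)

theorem map_matAct {R A : Type*} [CommRing R] [CommRing A] {n : ℕ} (φ : R →+* A)
    (M : Matrix (Fin n) (Fin n) R) (q : MvPolynomial (Fin n) R) :
    map φ (matAct M q) = matAct (M.map φ) (map φ q) := by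
  induction q using MvPolynomial.induction_on with
  | C a => simp [matAct]
  | add p q hp hq => simp only [map_add, hp, hq]
  | mul_X p i hp =>
    rw [map_mul, map_mul, hp, map_mul, map_mul]
    simp [matAct]

theorem mem_invariantsOf {R A : Type*} [CommRing R] [CommRing A] {n : ℕ} {φ : R →+* A}
    {G : Subgroup (GL (Fin n) R)} {p : MvPolynomial (Fin n) A} :
    p ∈ invariantsOf φ G ↔
      ∀ g ∈ G, matAct ((g : Matrix (Fin n) (Fin n) R).map φ) p = p := by
  simp [invariantsOf, Algebra.mem_iInf, AlgHom.mem_equalizer]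

theorem map_mem_invariantsOf_iff {R A : Type*} [CommRing R] [CommRing A] {n : ℕ} {φ : R →+* A}
    (hφ : Function.Injective φ) {G : Subgroup (GL (Fin n) R)} {q : MvPolynomial (Fin n) R} :
    map φ q ∈ invariantsOf φ G ↔ q ∈ invariantsOf (RingHom.id R) G := by
  simp only [mem_invariantsOf, ← map_matAct, (map_injective φ hφ).eq_iff, RingHom.coe_id,
    Matrix.map_id]

theorem map_aeval_eq_aeval_map {R A σ τ : Type*} [CommRing R] [CommRing A] (φ : R →+* A)
    (f : σ → MvPolynomial τ R) (F : MvPolynomial σ R) :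
    map φ (aeval f F) = aeval (fun i => map φ (f i)) (map φ F) := by
  induction F using MvPolynomial.induction_on with
  | C a => simp
  | add p q hp hq => simp only [map_add, hp, hq]
  | mul_X p i hp => simp only [map_mul, hp, aeval_X, map_X]

/-- Over a localization, the `f i` generate the invariants iff every invariant over the base ring
becomes a polynomial in the `f i` after clearing a denominator. -/
theorem adjoin_eq_invariantsOf_iff {R : Type*} [CommRing R] (M : Submonoid R) {A : Type*}
    [CommRing A] [Algebra R A] [IsLocalization M A] (hinj : Function.Injective (algebraMap R A))
    {n : ℕ} {G : Subgroup (GL (Fin n) R)} {f : Fin n → MvPolynomial (Fin n) R}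
    (hf : ∀ i, f i ∈ invariantsOf (RingHom.id R) G) :
    Algebra.adjoin A (Set.range fun i => map (algebraMap R A) (f i)) =
        invariantsOf (algebraMap R A) G ↔
      ∀ q ∈ invariantsOf (RingHom.id R) G, ∃ s ∈ M, s • q ∈ Algebra.adjoin R (Set.range f) := by
  let := algebraMvPolynomial (R := R) (S := A) (σ := Fin n)
  have clear (F : MvPolynomial (Fin n) A) :
      ∃ s ∈ M, ∃ F' : MvPolynomial (Fin n) R, map (algebraMap R A) F' = C (algebraMap R A s) * F := by
    obtain ⟨⟨F', ⟨_, s, hs, rfl⟩⟩, h⟩ := IsLocalization.surj (M.map (C (σ := Fin n))) F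
    refine ⟨s, hs, F', ?_⟩
    rw [← map_C, mul_comm]
    exact h.symm
  have hle : Algebra.adjoin A (Set.range fun i => map (algebraMap R A) (f i)) ≤
      invariantsOf (algebraMap R A) G :=
    Algebra.adjoin_le (Set.range_subset_iff.2 fun i => (map_mem_invariantsOf_iff hinj).2 (hf i))
  constructor
  · intro h q hq
    rw [← map_mem_invariantsOf_iff hinj, ← h, Algebra.adjoin_range_eq_range_aeval] at hq
    obtain ⟨F, hF⟩ := hq
    obtain ⟨s, hs, F', hF'⟩ := clear F
    refine ⟨s, hs, ?_⟩
    rw [Algebra.adjoin_range_eq_range_aeval]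
    refine ⟨F', map_injective _ hinj ?_⟩
    change map _ (aeval f F') = _
    change aeval _ F = _ at hF
    rw [map_aeval_eq_aeval_map, hF', map_mul, hF, smul_eq_C_mul, map_mul, map_C]
    simp
  · intro h
    refine le_antisymm hle fun p hp => ?_
    obtain ⟨s, hs, q, hq⟩ := clear p
    have hq' : q ∈ invariantsOf (RingHom.id R) G := by
      rw [← map_mem_invariantsOf_iff hinj, hq, ← smul_eq_C_mul]
      exact Subalgebra.smul_mem _ hp _
    obtain ⟨s', hs', hF⟩ := h q hq'
    rw [Algebra.adjoin_range_eq_range_aeval] at hF ⊢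
    obtain ⟨F, hF⟩ := hF
    change aeval f F = _ at hF
    obtain ⟨u, hu⟩ := IsLocalization.map_units A (⟨s', hs'⟩ * ⟨s, hs⟩ : M)
    refine ⟨(↑u⁻¹ : A) • map (algebraMap R A) F, ?_⟩
    change aeval _ _ = _
    rw [map_smul, ← map_aeval_eq_aeval_map, hF, smul_eq_C_mul q, map_mul, map_C, hq,
      ← mul_assoc, ← C_mul, ← map_mul, smul_eq_C_mul, ← mul_assoc, ← C_mul]
    have : (↑u⁻¹ : A) * algebraMap R A (s' * s) = 1 := by
      rw [show algebraMap R A (s' * s) = u from hu.symm, Units.inv_mul]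
    rw [this, C_1, one_mul]

/-- A non-integral element of the inverse of a nonzero maximal ideal. -/
theorem exists_mul_integral_of_isMaximal {R : Type*} [CommRing R] [IsDedekindDomain R]
    (K : Type*) [Field K] [Algebra R K] [IsFractionRing R K] {P : Ideal R} (hP : P.IsMaximal)
    (hP0 : P ≠ ⊥) :
    ∃ t : K, t ∉ (algebraMap R K).range ∧
      ∀ a, t * algebraMap R K a ∈ (algebraMap R K).range ↔ a ∈ P := by
  obtain ⟨t, ht, ht1⟩ := FractionalIdeal.exists_notMem_one_of_ne_bot (K := K) hP0 hP.ne_top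
  rw [FractionalIdeal.mem_inv_iff (by simpa using hP0)] at ht
  rw [FractionalIdeal.mem_one_iff] at ht1
  have key : ∀ a ∈ P, t * algebraMap R K a ∈ (algebraMap R K).range := fun a ha =>
    (FractionalIdeal.mem_one_iff _).1 (ht _ (FractionalIdeal.mem_coeIdeal_of_mem _ ha))
  refine ⟨t, ht1, fun a => ⟨fun ha => ?_, key a⟩⟩
  by_contra hn
  obtain ⟨b, c, hc, h1⟩ := hP.exists_inv hn
  refine ht1 (?_ : t ∈ (algebraMap R K).range)
  have : t = algebraMap R K b * (t * algebraMap R K a) + t * algebraMap R K c := by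
    have := congrArg (algebraMap R K) h1
    simp only [map_add, map_mul, map_one] at this
    linear_combination -t * this
  rw [this]
  exact add_mem (mul_mem ⟨b, rfl⟩ ha) (key c hc)

theorem exists_map_eq_C_mul_map_iff {R K σ : Type*} [CommRing R] [CommRing K] [Algebra R K]
    {P : Ideal R} {t : K}
    (ht : ∀ a, t * algebraMap R K a ∈ (algebraMap R K).range ↔ a ∈ P) (F : MvPolynomial σ R) :
    (∃ F', map (algebraMap R K) F' = C t * map (algebraMap R K) F) ↔
      map (Ideal.Quotient.mk P) F = 0 := by
  have h0 : map (Ideal.Quotient.mk P) F = 0 ↔ ∀ m, coeff m F ∈ P := by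
    simp [MvPolynomial.ext_iff, coeff_map, Ideal.Quotient.eq_zero_iff_mem]
  rw [h0]
  constructor
  · rintro ⟨F', h⟩ m
    rw [← ht]
    refine ⟨coeff m F', ?_⟩
    rw [← coeff_map, h, coeff_C_mul, coeff_map]
  · intro h
    refine mem_range_map_iff_coeffs_subset.2 ?_
    intro x hx
    obtain ⟨m, -, rfl⟩ := mem_coeffs_iff.1 hx
    rw [coeff_C_mul, coeff_map]
    exact (ht _).2 (h m)

/-- If the invariants are generated by the `f i`, so that division by constants can be carried out
inside `R[f]`, then the `f i` stay algebraically independent modulo every maximal ideal. -/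
theorem algebraicIndependent_quotient_of_adjoin_eq
    {R : Type*} [CommRing R] [IsDedekindDomain R]
    {K : Type*} [Field K] [Algebra R K] [IsFractionRing R K]
    {n : ℕ} {G : Subgroup (GL (Fin n) R)} {f : Fin n → MvPolynomial (Fin n) R}
    (hind : AlgebraicIndependent K fun i => map (algebraMap R K) (f i))
    (h : Algebra.adjoin R (Set.range f) = invariantsOf (RingHom.id R) G)
    {P : Ideal R} (hP : P.IsMaximal) :
    AlgebraicIndependent (R ⧸ P) fun i => map (Ideal.Quotient.mk P) (f i) := by
  have hinj := IsFractionRing.injective R K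
  rw [algebraicIndependent_iff]
  intro F₀ hF₀
  obtain ⟨F, rfl⟩ := map_surjective _ Ideal.Quotient.mk_surjective F₀
  rw [← map_aeval_eq_aeval_map] at hF₀
  by_cases hP0 : P = ⊥
  · subst hP0
    have hb : Function.Injective (Ideal.Quotient.mk (⊥ : Ideal R)) := by
      rw [RingHom.injective_iff_ker_eq_bot, Ideal.mk_ker]
    have h1 : aeval f F = 0 := map_injective _ hb (by rw [hF₀, map_zero])
    have h2 : map (algebraMap R K) F = 0 := by
      apply (algebraicIndependent_iff.1 hind)
      rw [← map_aeval_eq_aeval_map, h1, map_zero]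
    rw [map_injective _ hinj (h2.trans (map_zero _).symm), map_zero]
  · obtain ⟨t, -, ht⟩ := exists_mul_integral_of_isMaximal K hP hP0
    obtain ⟨q, hq⟩ := (exists_map_eq_C_mul_map_iff ht _).2 hF₀
    have hFinv : aeval f F ∈ invariantsOf (RingHom.id R) G := by
      rw [← h, Algebra.adjoin_range_eq_range_aeval]
      exact ⟨F, rfl⟩
    have hqinv : q ∈ invariantsOf (RingHom.id R) G := by
      rw [← map_mem_invariantsOf_iff hinj, hq, ← smul_eq_C_mul]
      exact Subalgebra.smul_mem _ ((map_mem_invariantsOf_iff hinj).2 hFinv) _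
    rw [← h, Algebra.adjoin_range_eq_range_aeval] at hqinv
    obtain ⟨H, rfl⟩ := hqinv
    refine (exists_map_eq_C_mul_map_iff ht F).1 ⟨H, hind ?_⟩
    change map _ (aeval f H) = _ at hq
    rw [← map_aeval_eq_aeval_map, hq, map_mul, ← map_aeval_eq_aeval_map]
    simp

/-- If the `f i` are algebraically independent modulo every maximal ideal, then `R[f]` contains
every polynomial with a nonzero multiple in `R[f]`. -/
theorem mem_adjoin_of_smul_mem_adjoin
    {R : Type*} [CommRing R] [IsDedekindDomain R] {n : ℕ} {f : Fin n → MvPolynomial (Fin n) R}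
    (h : ∀ P : Ideal R, P.IsMaximal →
      AlgebraicIndependent (R ⧸ P) fun i => map (Ideal.Quotient.mk P) (f i))
    {q : MvPolynomial (Fin n) R} {s : R} (hs : s ≠ 0)
    (hsq : s • q ∈ Algebra.adjoin R (Set.range f)) : q ∈ Algebra.adjoin R (Set.range f) := by
  let K := FractionRing R
  have hinj := IsFractionRing.injective R K
  let I : Ideal R := (Subalgebra.toSubmodule (Algebra.adjoin R (Set.range f))).comap
    (LinearMap.toSpanSingleton R _ q)
  have hI (a : R) : a ∈ I ↔ a • q ∈ Algebra.adjoin R (Set.range f) := Iff.rfl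
  suffices I = ⊤ by simpa [hI] using (Ideal.eq_top_iff_one I).1 this
  by_contra hne
  obtain ⟨P, hP, hIP⟩ := Ideal.exists_le_maximal I hne
  have hI0 : I ≠ ⊥ := fun h0 => hs (by simpa [h0] using (hI s).2 hsq)
  have hP0 : P ≠ ⊥ := fun h0 => hI0 (le_bot_iff.1 (h0 ▸ hIP))
  obtain ⟨t, ht1, ht⟩ := exists_mul_integral_of_isMaximal K hP hP0
  have hstep (a : R) (ha : a ∈ I) : ∃ b ∈ I, algebraMap R K b = t * algebraMap R K a := by
    obtain ⟨b, hb⟩ := (ht a).2 (hIP ha)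
    refine ⟨b, ?_, hb⟩
    rw [hI, Algebra.adjoin_range_eq_range_aeval] at ha ⊢
    obtain ⟨F, hF⟩ := ha
    change aeval f F = _ at hF
    have hF0 : map (Ideal.Quotient.mk P) F = 0 := by
      apply algebraicIndependent_iff.1 (h P hP)
      rw [← map_aeval_eq_aeval_map, hF, smul_eq_C_mul, map_mul, map_C,
        Ideal.Quotient.eq_zero_iff_mem.2 (hIP ((hI a).2 ?_)), C_0, zero_mul]
      rw [Algebra.adjoin_range_eq_range_aeval]
      exact ⟨F, hF⟩
    obtain ⟨F', hF'⟩ := (exists_map_eq_C_mul_map_iff ht F).2 hF0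
    refine ⟨F', map_injective _ hinj ?_⟩
    change map _ (aeval f F') = _
    rw [map_aeval_eq_aeval_map, hF', map_mul, ← map_aeval_eq_aeval_map, hF, smul_eq_C_mul,
      smul_eq_C_mul, map_mul, map_mul, map_C, map_C, hb, C_mul]
    simp [mul_assoc]
  refine ht1 (IsIntegrallyClosed.isIntegral_iff.1 (isIntegral_of_smul_mem_submodule
    (Submodule.map (Algebra.linearMap R K) I) ?_ ((IsNoetherian.noetherian I).map _) t ?_))
  · exact fun h0 => hI0 (Submodule.map_injective_of_injective
      (f := Algebra.linearMap R K) hinj (h0.trans (Submodule.map_bot _).symm))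
  · rintro _ ⟨a, ha, rfl⟩
    obtain ⟨b, hb, hbt⟩ := hstep a ha
    exact ⟨b, hb, hbt⟩

/-- let `R` be a Dedekind domain with quotient field `K`, let `L = R^n`, and
let `G ⊆ GL(L)` be a finite subgroup such that `K[L]^G` is a polynomial ring generated by
homogeneous `f_1, …, f_n ∈ R[L]`.  Then the following are equivalent:
(i) `R[f_1, …, f_n] = R[L]^G`;
(ii) for every maximal ideal `m ⊂ R`, `R_m[f_1, …, f_n] = R_m[L]^G`;
(iii) for every maximal ideal `m ⊂ R`, the residue classes of `f_1, …, f_n` modulo `m`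
are algebraically independent over `R/m`. -/
theorem invariants_adjoin_tfae
    {R : Type*} [CommRing R] [IsDedekindDomain R]
    {K : Type*} [Field K] [Algebra R K] [IsFractionRing R K]
    {n : ℕ} (G : Subgroup (GL (Fin n) R)) [Finite G]
    (f : Fin n → MvPolynomial (Fin n) R) (d : Fin n → ℕ)
    (hhom : ∀ i, (f i).IsHomogeneous (d i))
    (hind : AlgebraicIndependent K fun i => map (algebraMap R K) (f i))
    (hgen : Algebra.adjoin K (Set.range fun i => map (algebraMap R K) (f i)) =
      invariantsOf (algebraMap R K) G) :
    List.TFAE [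
      Algebra.adjoin R (Set.range f) = invariantsOf (RingHom.id R) G,
      ∀ (P : Ideal R) (hP : P.IsMaximal),
        haveI : P.IsPrime := hP.isPrime
        Algebra.adjoin (Localization.AtPrime P)
            (Set.range fun i => map (algebraMap R (Localization.AtPrime P)) (f i)) =
          invariantsOf (algebraMap R (Localization.AtPrime P)) G,
      ∀ (P : Ideal R), P.IsMaximal →
        AlgebraicIndependent (R ⧸ P) fun i => map (Ideal.Quotient.mk P) (f i)] := by
  have hinj := IsFractionRing.injective R K
  have hf (i : Fin n) : f i ∈ invariantsOf (RingHom.id R) G := by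
    rw [← map_mem_invariantsOf_iff hinj, ← hgen]
    exact Algebra.subset_adjoin ⟨i, rfl⟩
  have hle : Algebra.adjoin R (Set.range f) ≤ invariantsOf (RingHom.id R) G :=
    Algebra.adjoin_le (Set.range_subset_iff.2 hf)
  tfae_have 1 → 2 := fun h P hP => by
    have : P.IsPrime := hP.isPrime
    refine (adjoin_eq_invariantsOf_iff P.primeCompl
      (IsLocalization.injective _ P.primeCompl_le_nonZeroDivisors) hf).2 fun q hq => ?_
    exact ⟨1, one_mem _, by rwa [one_smul, h]⟩
  tfae_have 2 → 1 := fun h => by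
    refine le_antisymm hle fun q hq => ?_
    let I : Ideal R := (Subalgebra.toSubmodule (Algebra.adjoin R (Set.range f))).comap
      (LinearMap.toSpanSingleton R _ q)
    have hI (a : R) : a ∈ I ↔ a • q ∈ Algebra.adjoin R (Set.range f) := Iff.rfl
    suffices I = ⊤ by simpa [hI] using (Ideal.eq_top_iff_one I).1 this
    by_contra hne
    obtain ⟨P, hP, hIP⟩ := Ideal.exists_le_maximal I hne
    have : P.IsPrime := hP.isPrime
    obtain ⟨s, hs, hsq⟩ := (adjoin_eq_invariantsOf_iff P.primeCompl
      (IsLocalization.injective _ P.primeCompl_le_nonZeroDivisors) hf).1 (h P hP) q hq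
    exact hs (hIP hsq)
  tfae_have 1 → 3 := fun h P hP => algebraicIndependent_quotient_of_adjoin_eq hind h hP
  tfae_have 3 → 1 := fun h => by
    refine le_antisymm hle fun q hq => ?_
    obtain ⟨s, hs, hsq⟩ := (adjoin_eq_invariantsOf_iff (nonZeroDivisors R) hinj hf).1 hgen q hq
    exact mem_adjoin_of_smul_mem_adjoin h (nonZeroDivisors.ne_zero hs) hsq
  tfae_finish
end

section
/- Let n ≥ 3 and let L_0 = { (x_1, …, x_n) ∈ ℤ^n : x_1 + ⋯ + x_n = 0 } with the action of the symmetric group S_n by permutation of coordinates. Then the ring of invariants ℤ[L_0]^{S_n} is a polynomial ring over ℤ; more precisely, it is generated by the restrictions to L_0 of the elementary symmetric polynomials e_2, …, e_n, and these restrictions are algebraically independent over ℤ. -/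
open MvPolynomial

/-- The ideal `(e_1) ⊆ ℤ[x_1, …, x_n]` generated by the first elementary symmetric
polynomial `e_1 = x_1 + ⋯ + x_n`. -/
noncomputable def e1Ideal (n : ℕ) : Ideal (MvPolynomial (Fin n) ℤ) :=
  Ideal.span {esymm (Fin n) ℤ 1}

/-- The ring `ℤ[L_0]` of polynomial functions on
`L_0 = {(x_1, …, x_n) ∈ ℤ^n : Σ x_i = 0}`, realized as `ℤ[x_1, …, x_n]/(e_1)`.
The symmetric group `S_n` acts on it via permutation of the variables. -/
abbrev L0Ring (n : ℕ) : Type := MvPolynomial (Fin n) ℤ ⧸ e1Ideal n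

/-- The restrictions to `L_0` of the elementary symmetric polynomials `e_2, …, e_n`,
i.e. their residue classes in `ℤ[x_1, …, x_n]/(e_1)`. -/
noncomputable def esymmL0 (n : ℕ) (i : Fin (n - 1)) : L0Ring n :=
  Ideal.Quotient.mk (e1Ideal n) (esymm (Fin n) ℤ ((i : ℕ) + 2))

namespace MvPolynomial

variable {R : Type*} [CommRing R]

/-- The elementary symmetric polynomials `e_1, …, e_n` are algebraically independent. -/
lemma aeval_esymm_injective (n : ℕ) :
    Function.Injective
      (aeval (R := R) (fun i : Fin n ↦ esymm (Fin n) R ((i : ℕ) + 1))) := by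
  intro p q h
  refine esymmAlgHom_injective (σ := Fin n) R (Fintype.card_fin n).ge (Subtype.ext ?_)
  have hp := esymmAlgHom_apply (σ := Fin n) (R := R) p
  have hq := esymmAlgHom_apply (σ := Fin n) (R := R) q
  exact hp.trans (h.trans hq.symm)

lemma IsSymmetric.exists_aeval_esymm {n : ℕ} {p : MvPolynomial (Fin n) R} (hp : p.IsSymmetric) :
    ∃ t, aeval (R := R) (fun i : Fin n ↦ esymm (Fin n) R ((i : ℕ) + 1)) t = p := by
  obtain ⟨t, ht⟩ := esymmAlgHom_surjective (σ := Fin n) R (Fintype.card_fin n).le ⟨p, hp⟩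
  exact ⟨t, (esymmAlgHom_apply (σ := Fin n) t).symm.trans (congrArg Subtype.val ht)⟩

variable (R) in
/-- Substitution of `e_2, …, e_{m+1}` for the variables. -/
noncomputable def higherEsymm (m : ℕ) :
    MvPolynomial (Fin m) R →ₐ[R] MvPolynomial (Fin (m + 1)) R :=
  aeval fun i ↦ esymm (Fin (m + 1)) R ((i : ℕ) + 2)

lemma map_higherEsymm {S : Type*} [CommRing S] (f : R →+* S) {m : ℕ}
    (q : MvPolynomial (Fin m) R) :
    map f (higherEsymm R m q) = higherEsymm S m (map f q) := by
  have h : ((map f).comp (higherEsymm R m).toRingHom) =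
      (higherEsymm S m).toRingHom.comp (map f) := by
    ext i <;> simp [higherEsymm, map_esymm]
  exact congrArg (fun g ↦ g q) h

lemma isSymmetric_higherEsymm {m : ℕ} (q : MvPolynomial (Fin m) R) :
    (higherEsymm R m q).IsSymmetric := by
  intro σ
  have h : (rename σ).comp (higherEsymm R m) = higherEsymm R m := by
    ext i : 1
    simp [higherEsymm, rename_esymm]
  exact congrArg (fun g ↦ g q) h

lemma higherEsymm_eq_aeval_rename {m : ℕ} (q : MvPolynomial (Fin m) R) :
    higherEsymm R m q =
      aeval (fun i : Fin (m + 1) ↦ esymm (Fin (m + 1)) R ((i : ℕ) + 1)) (rename Fin.succ q) := by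
  rw [aeval_rename]
  rfl

lemma IsSymmetric.exists_dvd_sub_higherEsymm {m : ℕ} {p : MvPolynomial (Fin (m + 1)) R}
    (hp : p.IsSymmetric) :
    ∃ q, esymm (Fin (m + 1)) R 1 ∣ p - higherEsymm R m q := by
  obtain ⟨t, rfl⟩ := hp.exists_aeval_esymm
  let Z : MvPolynomial (Fin (m + 1)) R →ₐ[R] MvPolynomial (Fin m) R :=
    aeval (Fin.cases 0 X)
  refine ⟨Z t, ?_⟩
  let I := Ideal.span {esymm (Fin (m + 1)) R 1}
  rw [← Ideal.mem_span_singleton, ← Ideal.Quotient.eq]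
  have h : (Ideal.Quotient.mkₐ R I).comp
        (aeval (fun i : Fin (m + 1) ↦ esymm (Fin (m + 1)) R ((i : ℕ) + 1))) =
      (Ideal.Quotient.mkₐ R I).comp ((higherEsymm R m).comp Z) := by
    ext i : 1
    cases i using Fin.cases with
    | zero =>
      have h0 : Ideal.Quotient.mk I (esymm (Fin (m + 1)) R 1) = 0 :=
        Ideal.Quotient.eq_zero_iff_mem.2 (Ideal.mem_span_singleton_self _)
      simpa [Z] using h0
    | succ i => simp [Z, higherEsymm]
  exact congrArg (fun g ↦ g t) h

lemma esymm_one_ne_zero [Nontrivial R] (m : ℕ) : esymm (Fin (m + 1)) R 1 ≠ 0 := by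
  intro h
  have h' := congrArg (eval (Pi.single (0 : Fin (m + 1)) (1 : R))) h
  simp [esymm_one] at h'

lemma eq_zero_of_esymm_one_dvd_higherEsymm [IsDomain R] {m : ℕ} {q : MvPolynomial (Fin m) R}
    (h : esymm (Fin (m + 1)) R 1 ∣ higherEsymm R m q) : q = 0 := by
  obtain ⟨r, hr⟩ := h
  have hsymm : r.IsSymmetric := by
    intro σ
    have h1 := isSymmetric_higherEsymm q σ
    rw [hr, map_mul, rename_esymm] at h1
    exact mul_left_cancel₀ (esymm_one_ne_zero m) h1
  obtain ⟨t, rfl⟩ := hsymm.exists_aeval_esymm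
  have h2 : rename Fin.succ q = X 0 * t := by
    apply aeval_esymm_injective (R := R) (m + 1)
    rw [← higherEsymm_eq_aeval_rename, hr, map_mul, aeval_X]
    rfl
  have h3 := congrArg (aeval (Fin.cases 0 X : Fin (m + 1) → MvPolynomial (Fin m) R)) h2
  rw [aeval_rename, map_mul, aeval_X, Fin.cases_zero, zero_mul] at h3
  have h4 : (Fin.cases 0 X : Fin (m + 1) → MvPolynomial (Fin m) R) ∘ Fin.succ = X := rfl
  rwa [h4, aeval_X_left_apply] at h3

lemma exists_dvd_sub_higherEsymm_of_prime {m l : ℕ} (hl : l.Prime)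
    {p : MvPolynomial (Fin (m + 1)) ℤ} {q : MvPolynomial (Fin m) ℤ}
    (h : esymm (Fin (m + 1)) ℤ 1 ∣ C (l : ℤ) * p - higherEsymm ℤ m q) :
    ∃ q', esymm (Fin (m + 1)) ℤ 1 ∣ p - higherEsymm ℤ m q' := by
  have := Fact.mk hl
  have hq : C (l : ℤ) ∣ q := by
    rw [C_dvd_iff_zmod]
    apply eq_zero_of_esymm_one_dvd_higherEsymm
    have h' := map_dvd (map (σ := Fin (m + 1)) (Int.castRingHom (ZMod l))) h
    simpa [map_esymm, map_higherEsymm] using h'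
  obtain ⟨q', rfl⟩ := hq
  obtain ⟨r, hr⟩ := h
  have hC : higherEsymm ℤ m (C (l : ℤ)) = C (l : ℤ) := (higherEsymm ℤ m).commutes _
  rw [map_mul, hC, ← mul_sub] at hr
  have hdvd : C (l : ℤ) ∣ r := by
    rw [C_dvd_iff_zmod]
    have h' := congrArg (map (Int.castRingHom (ZMod l))) hr
    rw [map_mul, map_mul, map_esymm,
      (C_dvd_iff_zmod l (C (l : ℤ) : MvPolynomial (Fin (m + 1)) ℤ)).1 dvd_rfl, zero_mul] at h'
    exact (mul_eq_zero.1 h'.symm).resolve_left (esymm_one_ne_zero m)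
  obtain ⟨r', rfl⟩ := hdvd
  refine ⟨q', r', mul_left_cancel₀ (a := C (l : ℤ)) ?_ (hr.trans (mul_left_comm _ _ _))⟩
  simpa using hl.ne_zero

/-- The subring of `ℤ[x_1, …, x_{m+1}]/(e_1)` generated by `e_2, …, e_{m+1}` is saturated. -/
lemma exists_dvd_sub_higherEsymm_of_ne_zero {m N : ℕ} (hN : N ≠ 0)
    {p : MvPolynomial (Fin (m + 1)) ℤ} {q : MvPolynomial (Fin m) ℤ}
    (h : esymm (Fin (m + 1)) ℤ 1 ∣ C (N : ℤ) * p - higherEsymm ℤ m q) :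
    ∃ q', esymm (Fin (m + 1)) ℤ 1 ∣ p - higherEsymm ℤ m q' := by
  induction N using induction_on_primes generalizing q with
  | zero => exact absurd rfl hN
  | one => exact ⟨q, by simpa using h⟩
  | prime_mul l a hl ih =>
    rw [Nat.cast_mul, C_mul, mul_assoc] at h
    obtain ⟨q', hq'⟩ := exists_dvd_sub_higherEsymm_of_prime hl h
    exact ih (right_ne_zero_of_mul hN) hq'

lemma exists_dvd_sub_higherEsymm_of_rename {m : ℕ} {p : MvPolynomial (Fin (m + 1)) ℤ}
    (h : ∀ σ : Equiv.Perm (Fin (m + 1)), esymm (Fin (m + 1)) ℤ 1 ∣ rename σ p - p) :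
    ∃ q, esymm (Fin (m + 1)) ℤ 1 ∣ p - higherEsymm ℤ m q := by
  let s := ∑ σ : Equiv.Perm (Fin (m + 1)), rename σ p
  have hs : s.IsSymmetric := by
    intro τ
    simp only [s, map_sum, rename_rename]
    exact Fintype.sum_equiv (Equiv.mulLeft τ) _ _ fun σ ↦ rfl
  obtain ⟨q, hq⟩ := hs.exists_dvd_sub_higherEsymm
  refine exists_dvd_sub_higherEsymm_of_ne_zero
    (N := Fintype.card (Equiv.Perm (Fin (m + 1)))) (q := q) Fintype.card_ne_zero ?_
  have hsum : s - C ((Fintype.card (Equiv.Perm (Fin (m + 1))) : ℕ) : ℤ) * p =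
      ∑ σ : Equiv.Perm (Fin (m + 1)), (rename σ p - p) := by
    simp [s, Finset.sum_sub_distrib]
  have hd := dvd_sub hq (hsum ▸ Finset.dvd_sum fun σ _ ↦ h σ)
  rwa [sub_sub_sub_cancel_left] at hd

end MvPolynomial

lemma mk_e1Ideal_eq_iff {n : ℕ} {p q : MvPolynomial (Fin n) ℤ} :
    Ideal.Quotient.mk (e1Ideal n) p = Ideal.Quotient.mk (e1Ideal n) q ↔
      esymm (Fin n) ℤ 1 ∣ p - q := by
  rw [Ideal.Quotient.eq, e1Ideal, Ideal.mem_span_singleton]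

lemma aeval_esymmL0 {m : ℕ} (q : MvPolynomial (Fin m) ℤ) :
    aeval (esymmL0 (m + 1)) q = Ideal.Quotient.mk (e1Ideal (m + 1)) (higherEsymm ℤ m q) := by
  have h : aeval (esymmL0 (m + 1)) =
      (Ideal.Quotient.mkₐ ℤ (e1Ideal (m + 1))).comp (higherEsymm ℤ m) := by
    ext i : 1
    simp [higherEsymm, esymmL0]
  exact congrArg (fun g ↦ g q) h

lemma algebraicIndependent_esymmL0 (m : ℕ) : AlgebraicIndependent ℤ (esymmL0 (m + 1)) := by
  rw [algebraicIndependent_iff]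
  intro q hq
  rw [aeval_esymmL0, ← map_zero (Ideal.Quotient.mk (e1Ideal (m + 1))), mk_e1Ideal_eq_iff,
    sub_zero] at hq
  exact eq_zero_of_esymm_one_dvd_higherEsymm hq

/-- for `n ≥ 3`, the ring of invariants `ℤ[L_0]^{S_n}` is a polynomial ring
over `ℤ`: it is generated by the restrictions to `L_0` of `e_2, …, e_n`, and these
restrictions are algebraically independent over `ℤ`.  The invariant ring is the set of
elements of `ℤ[L_0] = ℤ[x_1, …, x_n]/(e_1)` fixed by the `S_n`-action induced by
permutation of the variables. -/
theorem L0_invariants_polynomial (n : ℕ) (hn : 3 ≤ n) :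
    (Algebra.adjoin ℤ (Set.range (esymmL0 n)) : Set (L0Ring n)) =
      {a | ∀ σ : Equiv.Perm (Fin n), ∀ p : MvPolynomial (Fin n) ℤ,
        Ideal.Quotient.mk (e1Ideal n) p = a →
          Ideal.Quotient.mk (e1Ideal n) (rename σ p) = a} ∧
    AlgebraicIndependent ℤ (esymmL0 n) ∧
    Nonempty (↥(Algebra.adjoin ℤ (Set.range (esymmL0 n))) ≃ₐ[ℤ] MvPolynomial (Fin (n - 1)) ℤ) := by
  obtain ⟨m, rfl⟩ : ∃ m, n = m + 1 := ⟨n - 1, by omega⟩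
  have hind := algebraicIndependent_esymmL0 m
  refine ⟨?_, hind, ⟨hind.aevalEquiv.symm⟩⟩
  ext a
  rw [SetLike.mem_coe, Algebra.adjoin_range_eq_range_aeval, AlgHom.mem_range]
  constructor
  · rintro ⟨q, rfl⟩ σ p hp
    rw [aeval_esymmL0, mk_e1Ideal_eq_iff] at hp ⊢
    have h := map_dvd (rename σ) hp
    rwa [map_sub, rename_esymm, isSymmetric_higherEsymm (m := m) q σ] at h
  · intro ha
    obtain ⟨p, rfl⟩ := Ideal.Quotient.mk_surjective a
    obtain ⟨q, hq⟩ := exists_dvd_sub_higherEsymm_of_rename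
      fun σ ↦ mk_e1Ideal_eq_iff.1 (ha σ p rfl)
    exact ⟨q, (aeval_esymmL0 q).trans (mk_e1Ideal_eq_iff.2 hq).symm⟩
end

section
/- Let n ≥ 3 and let p be a prime number. Then the residue classes of the elementary symmetric polynomials e_2, …, e_n in the quotient ring 𝔽_p[x_1, …, x_n]/(e_1) are algebraically independent over 𝔽_p, where e_1 = x_1 + ⋯ + x_n. -/
open MvPolynomial in
/-- A cofactor of a nonzero symmetric polynomial in a symmetric polynomial is symmetric. -/
theorem MvPolynomial.IsSymmetric.of_mul_left {σ R : Type*} [CommRing R] [IsDomain R]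
    {a g : MvPolynomial σ R} (ha : a.IsSymmetric) (ha0 : a ≠ 0) (h : (a * g).IsSymmetric) :
    g.IsSymmetric := fun e => by
  have he := h e
  rw [map_mul, ha e] at he
  exact mul_left_cancel₀ ha0 he

open MvPolynomial in
/-- Over a domain, the classes of `e_2, …, e_{m+1}` in the quotient by `(e_1)` of the polynomial
ring in `m + 1` variables are algebraically independent. -/
theorem MvPolynomial.algebraicIndependent_mk_esymm_add_two (m : ℕ) (R : Type*) [CommRing R]
    [IsDomain R] :
    AlgebraicIndependent R (fun i : Fin m =>
      Ideal.Quotient.mk (Ideal.span {esymm (Fin (m + 1)) R 1})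
        (esymm (Fin (m + 1)) R ((i : ℕ) + 2))) := by
  rw [algebraicIndependent_iff]
  intro F hF
  have hinj := esymmAlgHom_injective (σ := Fin (m + 1)) (n := m + 1) R (by simp)
  have hX : (esymmAlgHom (Fin (m + 1)) R (m + 1) (X 0) : MvPolynomial (Fin (m + 1)) R) =
      esymm (Fin (m + 1)) R 1 := by
    simp [esymmAlgHom_apply]
  have hF' : (esymmAlgHom (Fin (m + 1)) R (m + 1) (rename Fin.succ F) :
      MvPolynomial (Fin (m + 1)) R) =
      aeval (fun i : Fin m => esymm (Fin (m + 1)) R ((i : ℕ) + 2)) F := by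
    rw [esymmAlgHom_apply, aeval_rename]
    rfl
  have hmk : Ideal.Quotient.mkₐ R (Ideal.span {esymm (Fin (m + 1)) R 1})
      (aeval (fun i : Fin m => esymm (Fin (m + 1)) R ((i : ℕ) + 2)) F) = 0 := by
    rw [← hF, comp_aeval_apply]
    rfl
  obtain ⟨g, hg⟩ := Ideal.mem_span_singleton.mp (Ideal.Quotient.eq_zero_iff_mem.mp hmk)
  have he1 : esymm (Fin (m + 1)) R 1 ≠ 0 := by
    rw [← hX, Ne, ZeroMemClass.coe_eq_zero, map_eq_zero_iff _ hinj]
    exact X_ne_zero 0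
  have hgs : g.IsSymmetric := by
    refine (esymm_isSymmetric (Fin (m + 1)) R 1).of_mul_left he1 ?_
    rw [← hg, ← hF']
    exact (esymmAlgHom (Fin (m + 1)) R (m + 1) (rename Fin.succ F)).2
  obtain ⟨G, hG⟩ := esymmAlgHom_surjective (σ := Fin (m + 1)) (n := m + 1) R (by simp) ⟨g, hgs⟩
  have key : rename Fin.succ F = X 0 * G := by
    apply hinj
    apply Subtype.ext
    rw [hF', hg, map_mul, hG, MulMemClass.coe_mul, hX]
  have := congrArg (aeval (Fin.cases 0 X : Fin (m + 1) → MvPolynomial (Fin m) R)) key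
  rw [aeval_rename, map_mul, aeval_X, Fin.cases_zero, zero_mul] at this
  simpa [Function.comp_def] using this


/-- For `n ≥ 3` and a prime `p`, the residue classes of the elementary
symmetric polynomials `e_2, …, e_n` in `𝔽_p[x_1, …, x_n]/(e_1)` are algebraically
independent over `𝔽_p`. -/
theorem esymm_classes_algebraicIndependent_mod_e1 (n p : ℕ) (hn : 3 ≤ n) (hp : p.Prime) :
    AlgebraicIndependent (ZMod p) (fun i : Fin (n - 1) =>
      Ideal.Quotient.mk (Ideal.span {MvPolynomial.esymm (Fin n) (ZMod p) 1})
        (MvPolynomial.esymm (Fin n) (ZMod p) ((i : ℕ) + 2))) := by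
  have : Fact p.Prime := ⟨hp⟩
  obtain ⟨m, rfl⟩ : ∃ m, n = m + 1 := ⟨n - 1, by omega⟩
  exact MvPolynomial.algebraicIndependent_mk_esymm_add_two m (ZMod p)
end

section
/- Fix n ≥ 3 and a positive divisor d of n. Let E^{i,j} denote the (n−1)×(n−1) matrix whose (i,j)-entry is 1 and all other entries 0 (with E^{0,j} and E^{n,j} interpreted as the zero matrix), let F_k := I_{n−1} + E^{n−k−1,n−k} − 2E^{n−k,n−k} + E^{n−k+1,n−k} for 1 ≤ k ≤ n−1, and let V_d := d·E^{1,1} + Σ_{i=2}^{n−1} (E^{i,i} + (n−i)·E^{1,i}) ∈ GL_{n−1}(ℚ). Then: (a) for 1 ≤ k ≤ n−3 one has V_d^{−1} F_k V_d = F_k; (b) the first row of V_d^{−1} F_{n−2} V_d equals (1, n/d, 0, …, 0); (c) the first row of V_d^{−1} F_{n−1} V_d equals (1−n, −(n/d)(n−2), −(n/d)(n−3), …, −(n/d)). -/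
/-- The `(n-1) × (n-1)` rational matrix `E^{i,j}` (1-based indices `i`, `j`) whose
`(i,j)`-entry is `1` and all other entries are `0`; it is the zero matrix when `i` or `j`
is out of the range `1, …, n-1` (in particular `E^{0,j} = E^{n,j} = 0`). -/
def Emat (n i j : ℕ) : Matrix (Fin (n - 1)) (Fin (n - 1)) ℚ :=
  Matrix.of fun a b => if (a : ℕ) + 1 = i ∧ (b : ℕ) + 1 = j then 1 else 0

/-- `F_k = I_{n-1} + E^{n-k-1,n-k} - 2 E^{n-k,n-k} + E^{n-k+1,n-k}`. -/
def Fmat (n k : ℕ) : Matrix (Fin (n - 1)) (Fin (n - 1)) ℚ :=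
  1 + Emat n (n - k - 1) (n - k) - 2 • Emat n (n - k) (n - k) + Emat n (n - k + 1) (n - k)

/-- `V_d = d E^{1,1} + ∑_{i=2}^{n-1} (E^{i,i} + (n-i) E^{1,i})`. -/
def Vmat (n d : ℕ) : Matrix (Fin (n - 1)) (Fin (n - 1)) ℚ :=
  d • Emat n 1 1 + ∑ i ∈ Finset.Icc 2 (n - 1), (Emat n i i + (n - i) • Emat n 1 i)

open Matrix

/-- The `i`-th standard basis vector of `ℚ^{n-1}` with 1-based index `i`, zero when `i` is out of
the range `1, …, n-1`. -/
def basisVec (n i : ℕ) : Fin (n - 1) → ℚ := fun a => if (a : ℕ) + 1 = i then 1 else 0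

theorem basisVec_eq_single {n i : ℕ} (hi : 1 ≤ i) (hin : i < n) :
    basisVec n i = Pi.single ⟨i - 1, by omega⟩ 1 := by
  ext a
  simp only [basisVec, Pi.single_apply, Fin.ext_iff]
  congr 1
  apply propext
  omega

theorem basisVec_self (n : ℕ) : basisVec n n = 0 := by
  ext a
  have := a.2
  simp only [basisVec, Pi.zero_apply, ite_eq_right_iff]
  omega

theorem basisVec_zero (n : ℕ) : basisVec n 0 = 0 := by
  ext a
  simp [basisVec]

theorem Emat_eq_vecMulVec (n i j : ℕ) :
    Emat n i j = vecMulVec (basisVec n i) (basisVec n j) := by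
  ext a b
  simp only [Emat, of_apply, vecMulVec_apply, basisVec]
  split_ifs <;> simp_all

/-- `F_{n-c}` is a rank-one perturbation of the identity. -/
theorem Fmat_eq_one_add_vecMulVec {n k c : ℕ} (hc : n - k = c) :
    Fmat n k = 1 + vecMulVec
      (basisVec n (c - 1) - (2 : ℚ) • basisVec n c + basisVec n (c + 1)) (basisVec n c) := by
  subst hc
  ext a b
  simp only [Fmat, Emat_eq_vecMulVec, Matrix.add_apply, Matrix.sub_apply, Matrix.smul_apply,
    vecMulVec_apply, Pi.add_apply, Pi.sub_apply, Pi.smul_apply, smul_eq_mul]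
  rw [nsmul_eq_mul]
  push_cast
  ring

theorem Vmat_apply {n d : ℕ} (a b : Fin (n - 1)) :
    Vmat n d a b = if (a : ℕ) = 0 then (if (b : ℕ) = 0 then (d : ℚ) else n - 1 - (b : ℕ))
      else if a = b then 1 else 0 := by
  have ha := a.2
  have hb := b.2
  have hsum : (∑ i ∈ Finset.Icc 2 (n - 1), (Emat n i i + (n - i) • Emat n 1 i)) a b =
      if (b : ℕ) = 0 then 0
      else (if a = b then 1 else 0) + if (a : ℕ) = 0 then (n : ℚ) - 1 - (b : ℕ) else 0 := by
    have hterm (i : ℕ) : (Emat n i i + (n - i) • Emat n 1 i) a b =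
        if i = b + 1 then
          (if a = b then 1 else 0) + if (a : ℕ) = 0 then (n : ℚ) - 1 - (b : ℕ) else 0
        else 0 := by
      simp only [Matrix.add_apply, Matrix.smul_apply, Emat, of_apply, Fin.ext_iff]
      rw [nsmul_eq_mul]
      obtain rfl | hi := eq_or_ne i (b + 1)
      · rw [Nat.cast_sub (by omega)]
        split_ifs <;> first | omega | (simp; try ring)
      · simp [hi, hi.symm]
    rw [Matrix.sum_apply, Finset.sum_congr rfl fun i _ => hterm i, Finset.sum_ite_eq']
    simp only [Finset.mem_Icc]
    split_ifs <;> first | omega | rfl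
  rw [Vmat, Matrix.add_apply, hsum]
  simp only [Matrix.smul_apply, Emat, of_apply, Fin.ext_iff]
  rw [nsmul_eq_mul]
  split_ifs <;> first | omega | simp

theorem isUnit_det_Vmat {n d : ℕ} (hd : 0 < d) : IsUnit (Vmat n d).det := by
  rw [isUnit_iff_ne_zero, det_of_isUpperTriangular, Finset.prod_ne_zero_iff]
  · intro a _
    rw [Vmat_apply, if_pos (rfl : a = a)]
    split_ifs <;> simp [hd.ne']
  · intro a b hab
    have : (b : ℕ) < a := hab
    rw [Vmat_apply, if_neg (by omega), if_neg (by simp only [Fin.ext_iff]; omega)]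

theorem Vmat_mulVec_basisVec_one {n d : ℕ} (hn : 2 ≤ n) :
    Vmat n d *ᵥ basisVec n 1 = (d : ℚ) • basisVec n 1 := by
  rw [basisVec_eq_single le_rfl (by omega), mulVec_single_one]
  ext a
  simp only [col_apply, Vmat_apply, Pi.smul_apply, Pi.single_apply, Fin.ext_iff]
  split_ifs <;> first | omega | simp

theorem Vmat_mulVec_basisVec {n d i : ℕ} (hi : 2 ≤ i) (hin : i ≤ n) :
    Vmat n d *ᵥ basisVec n i = basisVec n i + ((n : ℚ) - i) • basisVec n 1 := by
  obtain rfl | hlt := hin.eq_or_lt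
  · simp [basisVec_self]
  rw [basisVec_eq_single (by omega) hlt, mulVec_single_one]
  ext a
  simp only [col_apply, Vmat_apply, Pi.smul_apply, Pi.add_apply, Pi.single_apply, Fin.ext_iff,
    basisVec]
  have : ((i - 1 : ℕ) : ℚ) = i - 1 := by push_cast [show 1 ≤ i by omega]; rfl
  rw [this]
  split_ifs <;> first | omega | simp

theorem basisVec_vecMul_Vmat {n d i : ℕ} (hi : 2 ≤ i) (hin : i < n) :
    basisVec n i ᵥ* Vmat n d = basisVec n i := by
  rw [basisVec_eq_single (by omega) hin, single_one_vecMul]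
  ext b
  simp only [row_apply, Vmat_apply, Pi.single_apply, Fin.ext_iff]
  split_ifs <;> first | omega | simp

theorem inv_mul_one_add_vecMulVec_mul {m R : Type*} [Fintype m] [DecidableEq m] [CommRing R]
    {V : Matrix m m R} (hV : IsUnit V.det) {u w : m → R} (v : m → R) (huw : V *ᵥ u = w) :
    V⁻¹ * (1 + vecMulVec w v) * V = 1 + vecMulVec u (v ᵥ* V) := by
  rw [mul_add, mul_one, add_mul, nonsing_inv_mul _ hV, mul_vecMulVec, vecMulVec_mul, ← huw,
    mulVec_mulVec, nonsing_inv_mul _ hV, one_mulVec]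

/-- for `n ≥ 3` and `d` a positive divisor of `n`:
(a) `V_d⁻¹ F_k V_d = F_k` for `1 ≤ k ≤ n-3`;
(b) the first row of `V_d⁻¹ F_{n-2} V_d` is `(1, n/d, 0, …, 0)`;
(c) the first row of `V_d⁻¹ F_{n-1} V_d` is `(1-n, -(n/d)(n-2), …, -(n/d))`. -/
theorem craig_matrices_conjugation (n d : ℕ) (hn : 3 ≤ n) (hd : d ∣ n) (hd0 : 0 < d) :
    (∀ k, 1 ≤ k → k ≤ n - 3 → (Vmat n d)⁻¹ * Fmat n k * Vmat n d = Fmat n k) ∧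
    (∀ j : Fin (n - 1), ((Vmat n d)⁻¹ * Fmat n (n - 2) * Vmat n d) ⟨0, by omega⟩ j =
      if (j : ℕ) = 0 then 1 else if (j : ℕ) = 1 then (n : ℚ) / d else 0) ∧
    (∀ j : Fin (n - 1), ((Vmat n d)⁻¹ * Fmat n (n - 1) * Vmat n d) ⟨0, by omega⟩ j =
      if (j : ℕ) = 0 then 1 - (n : ℚ)
      else -((n : ℚ) / d) * ((n : ℚ) - 1 - (j : ℕ))) := by
  have hV : IsUnit (Vmat n d).det := isUnit_det_Vmat hd0
  have hdq : (d : ℚ) ≠ 0 := by exact_mod_cast hd0.ne'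
  refine ⟨fun k hk1 hk => ?_, fun j => ?_, fun j => ?_⟩
  · obtain ⟨c, hc⟩ : ∃ c, n - k = c + 1 := ⟨n - k - 1, by omega⟩
    rw [Fmat_eq_one_add_vecMulVec hc, inv_mul_one_add_vecMulVec_mul hV _ (u := _) ?_,
      basisVec_vecMul_Vmat (by omega) (by omega)]
    rw [mulVec_add, mulVec_sub, mulVec_smul, Vmat_mulVec_basisVec (by omega) (by omega),
      Vmat_mulVec_basisVec (by omega) (by omega), Vmat_mulVec_basisVec (by omega) (by omega)]
    ext a
    simp
    ring
  · have hu : Vmat n d *ᵥ (((n : ℚ) / d) • basisVec n 1 - (2 : ℚ) • basisVec n 2 + basisVec n 3) =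
        basisVec n (2 - 1) - (2 : ℚ) • basisVec n 2 + basisVec n (2 + 1) := by
      rw [mulVec_add, mulVec_sub, mulVec_smul, mulVec_smul, Vmat_mulVec_basisVec_one (by omega),
        Vmat_mulVec_basisVec le_rfl (by omega), Vmat_mulVec_basisVec (by omega) hn]
      ext a
      simp
      field_simp
      ring
    rw [Fmat_eq_one_add_vecMulVec (c := 2) (by omega), inv_mul_one_add_vecMulVec_mul hV _ hu,
      basisVec_vecMul_Vmat le_rfl (by omega)]
    simp only [Matrix.add_apply, one_apply, vecMulVec_apply, basisVec, Fin.ext_iff, Pi.add_apply,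
      Pi.sub_apply, Pi.smul_apply]
    split_ifs <;> first | omega | simp
  · have hu : Vmat n d *ᵥ ((-(n : ℚ) / d) • basisVec n 1 + basisVec n 2) =
        basisVec n (1 - 1) - (2 : ℚ) • basisVec n 1 + basisVec n (1 + 1) := by
      rw [mulVec_add, mulVec_smul, Vmat_mulVec_basisVec_one (by omega),
        Vmat_mulVec_basisVec le_rfl (by omega)]
      ext a
      simp [basisVec_zero]
      field_simp
      ring
    rw [Fmat_eq_one_add_vecMulVec (c := 1) (by omega), inv_mul_one_add_vecMulVec_mul hV _ hu,
      basisVec_eq_single le_rfl (by omega), single_one_vecMul]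
    simp only [Matrix.add_apply, one_apply, vecMulVec_apply, basisVec, Fin.ext_iff, Pi.add_apply,
      Pi.smul_apply, Pi.single_apply, row_apply, Vmat_apply]
    split_ifs <;> first | omega | (simp; try field_simp; try ring)
end

section
/- Let n ≥ 5 and let d > 0 be a divisor of n, and let L_d denote Craig's integral representation of S_n of rank n−1 in which the transposition (k, k+1) acts by the matrix V_d^{−1} F_k V_d for 1 ≤ k ≤ n−1. If R is a ring with ℤ ⊆ R ⊆ ℚ such that the ring of invariants R[L_d]^{S_n} is isomorphic to a polynomial ring over R, then d/n ∈ R. -/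
set_option synthInstance.maxHeartbeats 1000000
set_option maxHeartbeats 1000000

open MvPolynomial

/-- The image of Craig's representation `L_d` of `S_n`: the subgroup of `GL_{n-1}(ℚ)`
generated by the images `V_d⁻¹ F_k V_d` of the adjacent transpositions `(k, k+1)`. -/
noncomputable def craigGroup (n d : ℕ) : Subgroup (GL (Fin (n - 1)) ℚ) :=
  Subgroup.closure {g | ∃ k, 1 ≤ k ∧ k ≤ n - 1 ∧
    (g : Matrix (Fin (n - 1)) (Fin (n - 1)) ℚ) = (Vmat n d)⁻¹ * Fmat n k * Vmat n d}

/-- The algebra endomorphism of `ℚ[x_1, …, x_m]` given by the linear substitution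
`x_i ↦ ∑_j M_{i,j} x_j` for a matrix `M`. -/
noncomputable def actQ {m : ℕ} (M : Matrix (Fin m) (Fin m) ℚ) :
    MvPolynomial (Fin m) ℚ →ₐ[ℚ] MvPolynomial (Fin m) ℚ :=
  aeval fun i => ∑ j, C (M i j) * X j

/-- For a subring `R ⊆ ℚ` and a subgroup `G ⊆ GL_m(ℚ)`, the invariant ring `R[x_1, …, x_m]^G`:
the `R`-subalgebra of `ℚ[x_1, …, x_m]` consisting of the polynomials with all coefficients
in `R` that are fixed by the substitution action of every element of `G`. -/
noncomputable def invariantRingQ {m : ℕ} (R : Subring ℚ) (G : Subgroup (GL (Fin m) ℚ)) :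
    Subalgebra ↥R (MvPolynomial (Fin m) ℚ) :=
  (MvPolynomial.mapAlgHom (R := ↥R) (σ := Fin m) (Algebra.ofId ↥R ℚ)).range ⊓
    Subalgebra.restrictScalars ↥R
      (⨅ g ∈ G, AlgHom.equalizer (actQ (g : Matrix (Fin m) (Fin m) ℚ)) (AlgHom.id ℚ _))

/-- `R[x_1, …, x_m]^G` is isomorphic to a polynomial ring over `R`. -/
def IsPolynomialRingQ {m : ℕ} (R : Subring ℚ) (G : Subgroup (GL (Fin m) ℚ)) : Prop :=
  ∃ k : ℕ, Nonempty (↥(invariantRingQ R G) ≃ₐ[↥R] MvPolynomial (Fin k) ↥R)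

/-- If a finite group acts on a domain `B` fixing a prime `p` and acting faithfully on `B / p`,
and `t` is invariant modulo `p`, then `t` is congruent modulo `p` to an invariant as soon as the
ring of invariants modulo `p` is root closed. -/
theorem exists_invariant_sub_dvd {B G : Type*} [CommRing B] [IsDomain B] [Group G] [Fintype G]
    (τ : G →* (B →+* B)) {p : B} (hp : Prime p) (hpτ : ∀ g, τ g p = p)
    (hfaithful : ∀ g, (∀ b, p ∣ τ g b - b) → g = 1)
    (hroot : ∀ a h N c : B, (∀ g, τ g a = a) → (∀ g, τ g h = h) → (∀ g, τ g N = N) →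
      (∀ g, τ g c = c) → ∀ k : ℕ, k ≠ 0 → a ^ k = h ^ k * N + p * c →
        ∃ q, (∀ g, τ g q = q) ∧ p ∣ a - h * q)
    {t : B} (ht : ∀ g, p ∣ τ g t - t) :
    ∃ q, (∀ g, τ g q = q) ∧ p ∣ q - t := by
  classical
  have hprime : (Ideal.span {p}).IsPrime := (Ideal.span_singleton_prime hp.ne_zero).2 hp
  set π := Ideal.Quotient.mk (Ideal.span {p}) with hπ
  have hπeq : ∀ x y : B, π x = π y ↔ p ∣ x - y := fun x y => by
    rw [hπ, Ideal.Quotient.eq, Ideal.mem_span_singleton]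
  have hmul : ∀ g h x, τ g (τ h x) = τ (g * h) x := fun g h x => by rw [map_mul]; rfl
  have hinj : Function.Injective
      fun g : G => ((π.comp (τ g) : B →+* _) : B →* B ⧸ Ideal.span {p}) := by
    intro g h hgh
    have key : h⁻¹ * g = 1 := by
      refine hfaithful _ fun b => ?_
      have h1 : π (τ g b) = π (τ h b) := DFunLike.congr_fun hgh b
      obtain ⟨c, hc⟩ := (hπeq _ _).1 h1
      refine ⟨τ h⁻¹ c, ?_⟩
      have h2 := congrArg (τ h⁻¹) hc
      rwa [map_sub, map_mul, hpτ, hmul, hmul, inv_mul_cancel, map_one] at h2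
    exact (inv_mul_eq_one.1 key).symm
  have hli := (linearIndependent_monoidHom B (B ⧸ Ideal.span {p})).comp _ hinj
  obtain ⟨b, hb⟩ : ∃ b, π (∑ g, τ g b) ≠ 0 := by
    by_contra! hcon
    have := Fintype.linearIndependent_iff.1 hli (fun _ => 1) (by
      ext b
      simpa using hcon b) 1
    exact one_ne_zero this
  have htrace : ∀ x h, τ h (∑ g, τ g x) = ∑ g, τ g x := fun x h => by
    rw [map_sum]
    exact Fintype.sum_equiv (Equiv.mulLeft h) _ _ fun g => hmul h g x
  have hnorm : ∀ h, τ h (∏ g, τ g t) = ∏ g, τ g t := fun h => by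
    rw [map_prod]
    exact Fintype.prod_equiv (Equiv.mulLeft h) _ _ fun g => hmul h g t
  have htπ : ∀ g, π (τ g t) = π t := fun g => (hπeq _ _).2 (ht g)
  have hprod : π (∑ g, τ g (b * t)) = π (∑ g, τ g b) * π t := by
    simp only [map_sum, map_mul, htπ, Finset.sum_mul]
  have hN : π (∏ g, τ g t) = π t ^ Fintype.card G := by
    simp [map_prod, htπ]
  obtain ⟨c, hc⟩ : p ∣ (∑ g, τ g (b * t)) ^ Fintype.card G -
      (∑ g, τ g b) ^ Fintype.card G * ∏ g, τ g t := by
    rw [← hπeq, map_pow, hprod, map_mul, hN, map_pow, mul_pow]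
  have hcinv : ∀ g, τ g c = c := fun g => by
    have h2 := congrArg (τ g) hc
    rw [map_sub, map_mul, map_pow, map_pow, htrace, htrace, hnorm, map_mul, hpτ, hc] at h2
    exact (mul_left_cancel₀ hp.ne_zero h2).symm
  obtain ⟨q, hq, hdvd⟩ := hroot (∑ g, τ g (b * t)) (∑ g, τ g b) (∏ g, τ g t) c (htrace _) (htrace b) hnorm hcinv (Fintype.card G)
    Fintype.card_ne_zero (by rw [← hc]; ring)
  refine ⟨q, hq, ?_⟩
  rw [← hπeq, hprod, map_mul] at hdvd
  rw [← hπeq]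
  exact (mul_left_cancel₀ hb hdvd).symm

/-- Modulo a maximal ideal `(p)`, a polynomial ring is closed under taking roots of fractions. -/
theorem MvPolynomial.exists_eq_mul_add_of_pow_eq {R σ : Type*} [CommRing R] {p : R}
    (hp : (Ideal.span {p}).IsMaximal) {a h N c : MvPolynomial σ R} {k : ℕ} (hk : k ≠ 0)
    (H : a ^ k = h ^ k * N + C p * c) : ∃ q r, a = h * q + C p * r := by
  let _ := Ideal.Quotient.field (Ideal.span {p})
  set π := Ideal.Quotient.mk (Ideal.span {p}) with hπ
  have hp0 : π p = 0 := by
    rw [hπ, Ideal.Quotient.eq_zero_iff_mem]; exact Ideal.mem_span_singleton_self p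
  have h1 : map π h ^ k ∣ map π a ^ k := by
    refine ⟨map π N, ?_⟩
    rw [← map_pow, H, map_add, map_mul, map_mul, map_C, hp0, map_pow]
    simp
  obtain ⟨q', hq'⟩ := (IsIntegrallyClosed.pow_dvd_pow_iff hk).1 h1
  obtain ⟨q, rfl⟩ := map_surjective π Ideal.Quotient.mk_surjective q'
  have h2 : a - h * q ∈ RingHom.ker (map (σ := σ) π) := by
    rw [RingHom.mem_ker, map_sub, map_mul, hq', sub_self]
  rw [ker_map, hπ, Ideal.mk_ker, Ideal.map_span, Set.image_singleton,
    Ideal.mem_span_singleton] at h2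
  obtain ⟨r, hr⟩ := h2
  exact ⟨q, r, by rw [← hr]; ring⟩

theorem Subring.inv_den_mem (R : Subring ℚ) {r : ℚ} (hr : r ∈ R) : (r.den : ℚ)⁻¹ ∈ R := by
  have hco : IsCoprime r.num (r.den : ℤ) := Rat.isCoprime_num_den r
  obtain ⟨u, v, huv⟩ := hco
  have hden : (r.den : ℚ) ≠ 0 := by exact_mod_cast r.den_ne_zero
  have hq : (u : ℚ) * r.num + v * r.den = 1 := by exact_mod_cast huv
  have hrd : r * r.den = r.num := Rat.mul_den_eq_num r
  have : (r.den : ℚ)⁻¹ = u * r + v := by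
    field_simp
    linear_combination (-1 : ℚ) * hq - u * hrd
  rw [this]
  exact R.add_mem (R.mul_mem (intCast_mem R u) hr) (intCast_mem R v)

/-- A prime number which is not invertible in a subring of `ℚ` generates a maximal ideal. -/
theorem Subring.isMaximal_span_natCast (R : Subring ℚ) {p : ℕ} (hp : p.Prime)
    (hpR : (p : ℚ)⁻¹ ∉ R) : (Ideal.span {(p : R)}).IsMaximal := by
  have hpq : (p : ℚ) ≠ 0 := by exact_mod_cast hp.ne_zero
  rw [Ideal.isMaximal_iff]
  refine ⟨fun h => ?_, fun J r hJ hr hrJ => ?_⟩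
  · obtain ⟨s, hs⟩ := Ideal.mem_span_singleton.1 h
    have hs' : (1 : ℚ) = p * s := by exact_mod_cast congrArg (Subtype.val) hs
    apply hpR
    rw [inv_eq_of_mul_eq_one_right hs'.symm]
    exact s.2
  · have hinv := R.inv_den_mem r.2
    have hrd : (r : ℚ) * (r : ℚ).den = (r : ℚ).num := Rat.mul_den_eq_num _
    have hden : ((r : ℚ).den : ℚ) ≠ 0 := by exact_mod_cast (r : ℚ).den_ne_zero
    have hnd : ¬ (p : ℤ) ∣ (r : ℚ).num := by
      rintro ⟨k, hk⟩
      apply hr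
      rw [Ideal.mem_span_singleton]
      refine ⟨⟨k * ((r : ℚ).den : ℚ)⁻¹, R.mul_mem (intCast_mem R k) hinv⟩, ?_⟩
      apply Subtype.ext
      push_cast
      rw [hk] at hrd
      push_cast at hrd
      field_simp
      linear_combination hrd
    obtain ⟨u, v, huv⟩ := (Int.isCoprime_iff_gcd_eq_one.2
      ((Nat.Prime.coprime_iff_not_dvd hp).2 (by rwa [← Int.natCast_dvd])) :
        IsCoprime (p : ℤ) (r : ℚ).num)
    have h1 : (1 : R) = (u : R) * p + (v * ((r : ℚ).den : R)) * r := by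
      apply Subtype.ext
      push_cast
      have : (u : ℚ) * p + v * (r : ℚ).num = 1 := by exact_mod_cast huv
      linear_combination (-1 : ℚ) * this - v * hrd
    rw [h1]
    exact J.add_mem (J.mul_mem_left _ (hJ (Ideal.mem_span_singleton_self _)))
      (J.mul_mem_left _ hrJ)

/-- If `e` is not invertible in a subring of `ℚ`, then neither is some prime factor of `e`. -/
theorem Subring.exists_prime_dvd_inv_notMem (R : Subring ℚ) {e : ℕ} (he : e ≠ 0)
    (heR : (e : ℚ)⁻¹ ∉ R) : ∃ p : ℕ, p.Prime ∧ p ∣ e ∧ (p : ℚ)⁻¹ ∉ R := by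
  induction e using Nat.recOnMul with
  | zero => exact absurd rfl he
  | one => exact absurd (by simp) heR
  | prime p hp => exact ⟨p, hp, dvd_rfl, heR⟩
  | mul a b iha ihb =>
    by_cases ha : (a : ℚ)⁻¹ ∈ R
    · have hb : (b : ℚ)⁻¹ ∉ R := fun hb => heR (by
        rw [Nat.cast_mul, mul_inv]; exact R.mul_mem ha hb)
      obtain ⟨p, hp, hpb, hpR⟩ := ihb (right_ne_zero_of_mul he) hb
      exact ⟨p, hp, hpb.mul_left a, hpR⟩
    · obtain ⟨p, hp, hpa, hpR⟩ := iha (left_ne_zero_of_mul he) ha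
      exact ⟨p, hp, hpa.mul_right b, hpR⟩

/-- The coefficient of `X l` in a polynomial, as an additive map. -/
noncomputable def MvPolynomial.linCoeff {R σ : Type*} [CommRing R] (l : σ) :
    MvPolynomial σ R →+ R :=
  (constantCoeff : MvPolynomial σ R →+* R).toAddMonoidHom.comp (pderiv l).toLinearMap.toAddMonoidHom

section LinCoeff

variable {R σ : Type*} [CommRing R]

theorem MvPolynomial.linCoeff_apply (l : σ) (f : MvPolynomial σ R) :
    linCoeff l f = constantCoeff (pderiv l f) := rfl

theorem MvPolynomial.linCoeff_X [DecidableEq σ] (l j : σ) :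
    linCoeff l (X j : MvPolynomial σ R) = if j = l then 1 else 0 := by
  rw [linCoeff_apply, pderiv_X, Pi.single_apply]
  split_ifs <;> simp_all

theorem MvPolynomial.linCoeff_C_mul (l : σ) (r : R) (f : MvPolynomial σ R) :
    linCoeff l (C r * f) = r * linCoeff l f := by
  simp [linCoeff_apply]

theorem MvPolynomial.linCoeff_rename (s : Equiv.Perm σ) (l : σ) (f : MvPolynomial σ R) :
    linCoeff (s l) (rename s f) = linCoeff l f := by
  rw [linCoeff_apply, pderiv_rename s.injective, constantCoeff_rename, linCoeff_apply]

theorem MvPolynomial.linCoeff_aeval {S ι : Type*} [CommRing S] [Algebra S R] [Fintype ι]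
    (w : ι → MvPolynomial σ R) (hw : ∀ i, constantCoeff (w i) = 0) (l : σ)
    (f : MvPolynomial ι S) :
    linCoeff l (aeval w f) = ∑ i, algebraMap S R (linCoeff i f) * linCoeff l (w i) := by
  classical
  have hcc : ∀ f : MvPolynomial ι S,
      constantCoeff (aeval w f) = algebraMap S R (constantCoeff f) := fun f => by
    induction f using MvPolynomial.induction_on with
    | C a => rw [aeval_C, IsScalarTower.algebraMap_apply S R (MvPolynomial σ R)]; simp [algebraMap_eq]
    | add f g hf hg => simp only [map_add, hf, hg]
    | mul_X f i hf => simp [hw]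
  induction f using MvPolynomial.induction_on with
  | C a =>
    rw [aeval_C, IsScalarTower.algebraMap_apply S R (MvPolynomial σ R)]
    simp [linCoeff_apply, algebraMap_eq]
  | add f g hf hg => simp only [map_add, hf, hg, add_mul, Finset.sum_add_distrib]
  | mul_X f i hf =>
    simp [linCoeff_apply, hcc, hw, Pi.single_apply, apply_ite]

end LinCoeff
section Craig

variable (N d : ℕ)

/-- The simple roots `y_a - y_{a+1}` of type `A`, as linear forms. -/
noncomputable def simpleRoot {m : ℕ} (a : Fin m) : MvPolynomial (Fin (m + 1)) ℚ :=
  X a.castSucc - X a.succ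

/-- The basis of Craig's lattice, as linear forms in the coordinates permuted by `S_n`. -/
noncomputable def craigForm : Fin (N + 1) → MvPolynomial (Fin (N + 2)) ℚ :=
  Fin.cons (C (1 / d : ℚ) * (∑ j, X j - C ((N : ℚ) + 2) * X 1)) fun a => simpleRoot a.succ

theorem craigForm_zero :
    craigForm N d 0 = C (1 / d : ℚ) * (∑ j, X j - C ((N : ℚ) + 2) * X 1) := rfl

theorem craigForm_succ (a : Fin N) : craigForm N d a.succ = simpleRoot a.succ := rfl

/-- Craig's matrix `V_d` for `n = N + 2`. -/
noncomputable def craigBasisMatrix : Matrix (Fin (N + 1)) (Fin (N + 1)) ℚ := Vmat (N + 2) d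

/-- The matrix of the reflection in the simple root with index `b`. -/
noncomputable def reflectionMatrix (b : Fin (N + 1)) : Matrix (Fin (N + 1)) (Fin (N + 1)) ℚ :=
  Fmat (N + 2) (N + 1 - b)

theorem reflectionMatrix_apply (b a c : Fin (N + 1)) :
    (reflectionMatrix N b) a c =
      (if a = c then 1 else 0) + if c = b then (if (a : ℕ) + 1 = b then 1 else 0) -
        2 * (if a = b then 1 else 0) + (if (a : ℕ) = b + 1 then 1 else 0) else 0 := by
  have hb : N + 2 - (N + 1 - (b : ℕ)) = b + 1 := by omega
  have hab : (a : ℕ) = b ↔ a = b := Fin.ext_iff.symm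
  have hcb : (c : ℕ) = b ↔ c = b := Fin.ext_iff.symm
  unfold reflectionMatrix Fmat
  rw [hb]
  simp only [Matrix.add_apply, Matrix.sub_apply, Matrix.smul_apply, Matrix.one_apply, Emat,
    Matrix.of_apply, Nat.add_sub_cancel, Nat.add_right_cancel_iff, hab, hcb]
  by_cases h : c = b
  · simp [h]; ring
  · simp [h]

theorem reflectionMatrix_mulVec_simpleRoot (b : Fin (N + 1)) :
    ((reflectionMatrix N b).map C).mulVec simpleRoot =
      fun a => rename (Equiv.swap b.castSucc b.succ) (simpleRoot a) := by
  ext1 a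
  have h1 : ((reflectionMatrix N b).map C).mulVec
      simpleRoot a = simpleRoot a + C ((if (a : ℕ) + 1 = b then 1 else 0) -
        2 * (if a = b then 1 else 0) + (if (a : ℕ) = b + 1 then 1 else 0)) * simpleRoot b := by
    simp only [Matrix.mulVec, dotProduct, Matrix.map_apply, reflectionMatrix_apply, map_add, add_mul,
      Finset.sum_add_distrib]
    congr 1
    · simp [apply_ite, ite_mul]
    · simp only [apply_ite C, ite_mul, map_zero, zero_mul, Finset.sum_ite_eq', Finset.mem_univ,
        if_true, map_add, add_mul]
  rw [h1]
  simp only [simpleRoot, map_sub, rename_X]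
  rcases lt_trichotomy a b with h | h | h
  · have h2 : Equiv.swap b.castSucc b.succ a.castSucc = a.castSucc :=
      Equiv.swap_apply_of_ne_of_ne (by simp [Fin.ext_iff]; omega) (by simp [Fin.ext_iff]; omega)
    by_cases h3 : (a : ℕ) + 1 = b
    · have h4 : a.succ = b.castSucc := by simp [Fin.ext_iff, h3]
      rw [h2, h4, Equiv.swap_apply_left, if_pos h3, if_neg h.ne, if_neg (by omega)]
      simp
    · rw [h2, Equiv.swap_apply_of_ne_of_ne (by simp [Fin.ext_iff]; omega)
        (by simp [Fin.ext_iff]; omega), if_neg h3, if_neg h.ne, if_neg (by omega)]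
      simp
  · subst h
    rw [Equiv.swap_apply_left, Equiv.swap_apply_right, if_neg (by omega), if_pos rfl,
      if_neg (by omega)]
    simp only [map_add, map_sub, map_mul, map_zero, map_one]
    rw [show (C (2 : ℚ) : MvPolynomial (Fin (N + 2)) ℚ) = 2 from rfl]
    ring
  · have h2 : Equiv.swap b.castSucc b.succ a.succ = a.succ :=
      Equiv.swap_apply_of_ne_of_ne (by simp [Fin.ext_iff]; omega) (by simp [Fin.ext_iff]; omega)
    by_cases h3 : (a : ℕ) = b + 1
    · have h4 : a.castSucc = b.succ := by simp [Fin.ext_iff, h3]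
      rw [h2, h4, Equiv.swap_apply_right, if_pos h3, if_neg h.ne', if_neg (by omega)]
      simp
    · rw [h2, Equiv.swap_apply_of_ne_of_ne (by simp [Fin.ext_iff]; omega)
        (by simp [Fin.ext_iff]; omega), if_neg h3, if_neg h.ne', if_neg (by omega)]
      simp

theorem craigBasisMatrix_apply (a b : Fin (N + 1)) :
    (craigBasisMatrix N d) a b =
      if a = 0 then (if b = 0 then (d : ℚ) else (N : ℚ) + 1 - b) else if a = b then 1 else 0 := by
  have hsum : ∀ f : ℕ → ℚ, ∑ i ∈ Finset.Icc 2 (N + 1), (if (b : ℕ) + 1 = i then f i else 0) =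
      if b = 0 then 0 else f (b + 1) := fun f => by
    rw [Finset.sum_ite_eq]
    rcases eq_or_ne b 0 with rfl | hb
    · simp
    · have : (b : ℕ) ≠ 0 := fun h => hb (Fin.ext h)
      rw [if_pos (by simp; omega), if_neg hb]
  have ha0 : (a : ℕ) = 0 ↔ a = 0 := ⟨fun h => Fin.ext h, fun h => by rw [h]; rfl⟩
  have hb0 : (b : ℕ) = 0 ↔ b = 0 := ⟨fun h => Fin.ext h, fun h => by rw [h]; rfl⟩
  have hab : (a : ℕ) = b ↔ a = b := Fin.ext_iff.symm
  have hN : ((N + 2 - ((b : ℕ) + 1) : ℕ) : ℚ) = N + 1 - b := by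
    rw [Nat.cast_sub (by omega)]; push_cast; ring
  have h1 : ∀ i, (Emat (N + 2) i i + (N + 2 - i) • Emat (N + 2) 1 i :
      Matrix (Fin (N + 1)) (Fin (N + 1)) ℚ) a b = if (b : ℕ) + 1 = i then
        ((if (a : ℕ) + 1 = i then 1 else 0) + ((N + 2 - i : ℕ) : ℚ) * (if a = 0 then 1 else 0))
          else 0 := fun i => by
    simp only [Matrix.add_apply, Matrix.smul_apply, Emat, Matrix.of_apply, Nat.add_eq_right, ha0]
    split_ifs <;> simp_all
  unfold craigBasisMatrix Vmat
  erw [Matrix.add_apply, Matrix.smul_apply, Matrix.sum_apply]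
  rw [Finset.sum_congr rfl fun i _ => h1 i]
  erw [hsum]
  rw [hN]
  simp only [Emat, Matrix.of_apply, Nat.add_eq_right, ha0, hb0, Nat.add_right_cancel_iff, hab]
  rcases eq_or_ne a 0 with rfl | ha <;> rcases eq_or_ne b 0 with rfl | hb
  · simp
  · simp [hb, hb.symm]
  · simp [ha]
  · simp [ha, hb]

theorem sum_range_mul_sub {A : Type*} [CommRing A] (Y : ℕ → A) (n : ℕ) :
    ∑ b ∈ Finset.range n, ((n : A) - b) * (Y b - Y (b + 1)) =
      (n + 1) * Y 0 - ∑ i ∈ Finset.range (n + 1), Y i := by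
  induction n with
  | zero => simp
  | succ n ih =>
    have h : ∀ b ∈ Finset.range n, (((n + 1 : ℕ) : A) - b) * (Y b - Y (b + 1)) =
        ((n : A) - b) * (Y b - Y (b + 1)) + (Y b - Y (b + 1)) := fun b _ => by push_cast; ring
    rw [Finset.sum_range_succ, Finset.sum_congr rfl h, Finset.sum_add_distrib, ih,
      Finset.sum_range_sub', Finset.sum_range_succ _ (n + 1)]
    push_cast
    ring

theorem craigBasisMatrix_mulVec_craigForm (hd0 : 0 < d) :
    ((craigBasisMatrix N d).map C).mulVec (craigForm N d) =
      simpleRoot := by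
  ext1 a
  simp only [Matrix.mulVec, dotProduct, Matrix.map_apply, craigBasisMatrix_apply]
  refine Fin.cases ?_ (fun a => ?_) a
  · have hd : (d : ℚ) ≠ 0 := by exact_mod_cast hd0.ne'
    rw [Fin.sum_univ_succ, craigForm_zero, if_pos rfl, if_pos rfl, ← mul_assoc, ← C_mul,
      mul_one_div_cancel hd, C_1, one_mul]
    let Y : ℕ → MvPolynomial (Fin (N + 2)) ℚ := fun i =>
      if h : i + 1 < N + 2 then X ⟨i + 1, h⟩ else 0
    have hY : ∀ i : Fin (N + 1), Y i = X i.succ := fun i =>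
      dif_pos (Nat.succ_lt_succ i.isLt)
    have h := sum_range_mul_sub Y N
    rw [Finset.sum_range, Finset.sum_range] at h
    have h1 : ∀ b : Fin N, C (if (0 : Fin (N + 1)) = 0 then (if b.succ = 0 then (d : ℚ) else
        (N : ℚ) + 1 - (b.succ : Fin (N + 1))) else if 0 = b.succ then 1 else 0) *
          craigForm N d b.succ =
        ((N : MvPolynomial (Fin (N + 2)) ℚ) - ((b : ℕ) : MvPolynomial (Fin (N + 2)) ℚ)) *
          (Y b - Y (b + 1)) := fun b => by
      rw [if_pos rfl, if_neg (Fin.succ_ne_zero b), craigForm_succ, simpleRoot]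
      have e1 : Y b = X b.succ.castSucc := hY b.castSucc
      have e2 : Y (b + 1) = X b.succ.succ := hY b.succ
      rw [e1, e2]
      congr 1
      simp
    rw [Finset.sum_congr rfl fun b _ => h1 b, h, Finset.sum_congr rfl fun i _ => hY i,
      Fin.sum_univ_succ, simpleRoot]
    have e0 : Y 0 = X 1 := hY 0
    rw [e0, show (0 : Fin (N + 1)).castSucc = 0 from rfl, show (0 : Fin (N + 1)).succ = 1 from rfl]
    simp only [map_add, map_natCast]
    rw [show (C (2 : ℚ) : MvPolynomial (Fin (N + 2)) ℚ) = 2 from rfl]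
    ring
  · simp [craigForm_succ, apply_ite, ite_mul]

theorem isUnit_det_craigBasisMatrix (hd0 : 0 < d) :
    IsUnit (craigBasisMatrix N d).det := by
  rw [Matrix.det_of_isUpperTriangular, isUnit_iff_ne_zero, Finset.prod_ne_zero_iff]
  · intro a _
    rw [craigBasisMatrix_apply]
    split_ifs <;> simp_all [hd0.ne']
  · intro a b hab
    have hab : b < a := hab
    rw [craigBasisMatrix_apply, if_neg (Fin.ne_zero_of_lt hab), if_neg hab.ne']

theorem inv_craigBasisMatrix_mulVec_simpleRoot (hd0 : 0 < d) :
    ((craigBasisMatrix N d)⁻¹.map C).mulVec simpleRoot =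
      craigForm N d := by
  rw [← craigBasisMatrix_mulVec_craigForm N d hd0, Matrix.mulVec_mulVec, ← Matrix.map_mul,
    Matrix.nonsing_inv_mul _ (isUnit_det_craigBasisMatrix N d hd0),
    Matrix.map_one _ (map_zero C) (map_one C), Matrix.one_mulVec]

theorem aeval_craigForm_injective (hd0 : 0 < d) :
    Function.Injective (aeval (craigForm N d) :
      MvPolynomial (Fin (N + 1)) ℚ →ₐ[ℚ] MvPolynomial (Fin (N + 2)) ℚ) := by
  set V := craigBasisMatrix N d with hV
  set β : Fin (N + 1) → MvPolynomial (Fin (N + 1)) ℚ := (V.map C).mulVec X with hβ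
  let φ : MvPolynomial (Fin (N + 2)) ℚ →ₐ[ℚ] MvPolynomial (Fin (N + 1)) ℚ :=
    aeval fun j => -∑ a, if a.castSucc < j then β a else 0
  have hφ : ∀ a, φ (simpleRoot a) = β a := fun a => by
    simp only [φ, simpleRoot, map_sub, aeval_X, neg_sub_neg, ← Finset.sum_sub_distrib]
    rw [Finset.sum_eq_single a]
    · simp
    · intro c _ hc
      have : c.castSucc < a.succ ↔ c.castSucc < a.castSucc := by
        simp only [Fin.lt_def, Fin.val_castSucc, Fin.val_succ]
        have : (c : ℕ) ≠ a := fun h => hc (Fin.ext h)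
        omega
      simp only [this, sub_self]
    · simp
  have hφw : ∀ i, φ (craigForm N d i) = X i := fun i => by
    rw [← inv_craigBasisMatrix_mulVec_simpleRoot N d hd0]
    have h1 : φ (((V⁻¹.map C).mulVec simpleRoot) i) = ((V⁻¹.map C).mulVec β) i := by
      simp [Matrix.mulVec, dotProduct, hφ, algHom_C, algebraMap_eq]
    rw [h1, hβ, Matrix.mulVec_mulVec, ← Matrix.map_mul,
      Matrix.nonsing_inv_mul _ (isUnit_det_craigBasisMatrix N d hd0),
      Matrix.map_one _ (map_zero C) (map_one C), Matrix.one_mulVec]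
  have hcomp : φ.comp (aeval (craigForm N d)) = AlgHom.id ℚ _ := by
    ext1 i
    simp [hφw]
  exact Function.LeftInverse.injective (g := φ) fun f => DFunLike.congr_fun hcomp f

theorem aeval_craigForm_actQ (hd0 : 0 < d) (b : Fin (N + 1))
    (M : Matrix (Fin (N + 1)) (Fin (N + 1)) ℚ)
    (hM : M = (craigBasisMatrix N d)⁻¹ * reflectionMatrix N b * craigBasisMatrix N d)
    (f : MvPolynomial (Fin (N + 1)) ℚ) :
    aeval (craigForm N d) (actQ M f) =
      rename (Equiv.swap b.castSucc b.succ) (aeval (craigForm N d) f) := by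
  have key : (M.map C).mulVec (craigForm N d) =
      fun i => rename (Equiv.swap b.castSucc b.succ) (craigForm N d i) := by
    have h1 := inv_craigBasisMatrix_mulVec_simpleRoot N d hd0
    rw [hM, Matrix.map_mul, Matrix.map_mul, ← Matrix.mulVec_mulVec, craigBasisMatrix_mulVec_craigForm N d hd0,
      ← Matrix.mulVec_mulVec, reflectionMatrix_mulVec_simpleRoot]
    ext1 i
    rw [← h1]
    simp [Matrix.mulVec, dotProduct]
  have hcomp : (aeval (craigForm N d)).comp (actQ M) =
      ((rename (Equiv.swap b.castSucc b.succ)).comp (aeval (craigForm N d)) :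
        MvPolynomial (Fin (N + 1)) ℚ →ₐ[ℚ] MvPolynomial (Fin (N + 2)) ℚ) := by
    ext1 i
    simp only [AlgHom.comp_apply, actQ, aeval_X, ← congrFun key i]
    simp [Matrix.mulVec, dotProduct, algHom_C, algebraMap_eq]
  exact DFunLike.congr_fun hcomp f

theorem reflectionMatrix_mul_self (b : Fin (N + 1)) :
    reflectionMatrix N b * reflectionMatrix N b = 1 := by
  obtain ⟨u, hu⟩ : ∃ u : Fin (N + 1) → ℚ, ∀ a, u a = (if (a : ℕ) + 1 = b then 1 else 0) -
    2 * (if a = b then 1 else 0) + (if (a : ℕ) = b + 1 then 1 else 0) := ⟨_, fun _ => rfl⟩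
  have hub : u b = -2 := by simp [hu]
  have happ : ∀ a c, reflectionMatrix N b a c =
      (if a = c then 1 else 0) + if c = b then u a else 0 := fun a c => by
    rw [reflectionMatrix_apply, hu]
  ext a c
  rw [Matrix.mul_apply]
  simp only [happ]
  rcases eq_or_ne c b with rfl | h
  · have h1 : ∀ x, ((if a = x then 1 else 0) + if x = c then u a else 0) *
        ((if x = c then 1 else 0) + if c = c then u x else 0) =
        (if x = c then (if a = c then 1 else 0) + u a + u a * u c else 0) +
          if a = x then u a else 0 := fun x => by
      clear hu happ hub
      rcases eq_or_ne x c with rfl | hx <;> rcases eq_or_ne a x with rfl | ha <;>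
        simp_all <;> ring
    rw [Finset.sum_congr rfl fun x _ => h1 x, Finset.sum_add_distrib, Finset.sum_ite_eq',
      Finset.sum_ite_eq, if_pos (Finset.mem_univ _), if_pos (Finset.mem_univ _), hub,
      Matrix.one_apply]
    ring
  · simp [h, Matrix.one_apply]

theorem actQ_one {m : ℕ} : actQ (1 : Matrix (Fin m) (Fin m) ℚ) = AlgHom.id ℚ _ := by
  ext1 i
  simp [actQ, Matrix.one_apply, apply_ite C, ite_mul]

theorem actQ_mul {m : ℕ} (M M' : Matrix (Fin m) (Fin m) ℚ) :
    actQ (M * M') = (actQ M').comp (actQ M) := by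
  ext1 i
  simp only [actQ, AlgHom.comp_apply, aeval_X, map_sum, map_mul, algHom_C, algebraMap_eq,
    Matrix.mul_apply, Finset.sum_mul, Finset.mul_sum]
  rw [Finset.sum_comm]
  simp only [mul_assoc]

/-- Craig's group for `n = N + 2`. -/
noncomputable def craigGroupSucc : Subgroup (GL (Fin (N + 1)) ℚ) := craigGroup (N + 2) d

theorem craigGroupSucc_eq_closure : craigGroupSucc N d = Subgroup.closure
    {g : GL (Fin (N + 1)) ℚ | ∃ b : Fin (N + 1), (g : Matrix (Fin (N + 1)) (Fin (N + 1)) ℚ) =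
      (craigBasisMatrix N d)⁻¹ * reflectionMatrix N b * craigBasisMatrix N d} := by
  unfold craigGroupSucc craigGroup
  refine congrArg Subgroup.closure (Set.ext fun g => ⟨?_, ?_⟩)
  · rintro ⟨k, hk1, hk2, hg⟩
    have hk2 : k ≤ N + 1 := hk2
    refine ⟨⟨N + 1 - k, by omega⟩, ?_⟩
    rw [reflectionMatrix, show N + 1 - (N + 1 - k) = k by omega]
    exact hg
  · rintro ⟨b, hg⟩
    exact ⟨N + 1 - b, by omega, show N + 1 - (b : ℕ) ≤ N + 1 by omega, hg⟩

theorem actQ_invariant_iff (hd0 : 0 < d) (f : MvPolynomial (Fin (N + 1)) ℚ) :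
    (∀ g ∈ craigGroupSucc N d, actQ (g : Matrix (Fin (N + 1)) (Fin (N + 1)) ℚ) f = f) ↔
      ∀ s : Equiv.Perm (Fin (N + 2)),
        rename s (aeval (craigForm N d) f) = aeval (craigForm N d) f := by
  rw [craigGroupSucc_eq_closure]
  constructor
  · intro h s
    have hs : s ∈ Submonoid.closure
        (Set.range fun i : Fin (N + 1) => Equiv.swap i.castSucc i.succ) := by
      rw [Equiv.Perm.mclosure_swap_castSucc_succ]; trivial
    induction hs using Submonoid.closure_induction with
    | mem s hs =>
      obtain ⟨b, rfl⟩ := hs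
      set M := (craigBasisMatrix N d)⁻¹ * reflectionMatrix N b * craigBasisMatrix N d with hM
      have hMM : M * M = 1 := by
        have hV := Matrix.mul_nonsing_inv _ (isUnit_det_craigBasisMatrix N d hd0)
        calc M * M = (craigBasisMatrix N d)⁻¹ * reflectionMatrix N b *
              (craigBasisMatrix N d * (craigBasisMatrix N d)⁻¹) * reflectionMatrix N b *
                craigBasisMatrix N d := by simp only [hM, Matrix.mul_assoc]
          _ = (craigBasisMatrix N d)⁻¹ * (reflectionMatrix N b * reflectionMatrix N b) *
                craigBasisMatrix N d := by rw [hV, Matrix.mul_one, ← Matrix.mul_assoc]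
          _ = 1 := by
            rw [reflectionMatrix_mul_self, Matrix.mul_one,
              Matrix.nonsing_inv_mul _ (isUnit_det_craigBasisMatrix N d hd0)]
      have := h ⟨M, M, hMM, hMM⟩ (Subgroup.subset_closure ⟨b, rfl⟩)
      rw [← aeval_craigForm_actQ N d hd0 b M hM]
      exact congrArg _ this
    | one => simp
    | mul s t _ _ hs ht =>
      have : rename (⇑(s * t)) (aeval (craigForm N d) f) =
          rename s (rename t (aeval (craigForm N d) f)) := by
        rw [rename_rename]; rfl
      rw [this, ht, hs]
  · intro h g hg
    induction hg using Subgroup.closure_induction with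
    | mem g hg =>
      obtain ⟨b, hb⟩ := hg
      apply aeval_craigForm_injective N d hd0
      rw [aeval_craigForm_actQ N d hd0 b _ hb, h]
    | one => rw [Units.val_one, actQ_one]; rfl
    | mul g g' _ _ hg hg' => rw [Units.val_mul, actQ_mul, AlgHom.comp_apply, hg, hg']
    | inv g _ hg =>
      have h1 := DFunLike.congr_fun (actQ_mul (g : Matrix (Fin (N + 1)) (Fin (N + 1)) ℚ)
        ((g⁻¹ : GL (Fin (N + 1)) ℚ) : Matrix (Fin (N + 1)) (Fin (N + 1)) ℚ)) f
      rw [← Units.val_mul, mul_inv_cancel, Units.val_one, actQ_one, AlgHom.comp_apply, hg] at h1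
      exact h1.symm

variable (R : Subring ℚ)

/-- The embedding of the polynomial functions over `R` on Craig's lattice into the polynomial
ring in the coordinates permuted by `S_n`. -/
noncomputable def craigEmbedding :
    MvPolynomial (Fin (N + 1)) R →ₐ[R] MvPolynomial (Fin (N + 2)) ℚ :=
  aeval (craigForm N d)

theorem craigEmbedding_eq (f : MvPolynomial (Fin (N + 1)) R) :
    craigEmbedding N d R f = aeval (craigForm N d) (map (algebraMap R ℚ) f) :=
  (aeval_map_algebraMap ℚ _ f).symm

theorem craigEmbedding_X (i : Fin (N + 1)) :
    craigEmbedding N d R (X i) = craigForm N d i := aeval_X _ _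

theorem craigEmbedding_injective (hd0 : 0 < d) : Function.Injective (craigEmbedding N d R) := by
  intro f g hfg
  rw [craigEmbedding_eq, craigEmbedding_eq] at hfg
  exact map_injective _ Subtype.val_injective (aeval_craigForm_injective N d hd0 hfg)

theorem mem_invariantRingQ_iff (hd0 : 0 < d) (x : MvPolynomial (Fin (N + 1)) ℚ) :
    x ∈ invariantRingQ R (craigGroupSucc N d) ↔ ∃ f : MvPolynomial (Fin (N + 1)) R,
      map (algebraMap R ℚ) f = x ∧ ∀ s : Equiv.Perm (Fin (N + 2)),
        rename s (craigEmbedding N d R f) = craigEmbedding N d R f := by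
  have h : x ∈ invariantRingQ R (craigGroupSucc N d) ↔
      (∃ f : MvPolynomial (Fin (N + 1)) R, map (algebraMap R ℚ) f = x) ∧
        ∀ g ∈ craigGroupSucc N d, actQ (g : Matrix (Fin (N + 1)) (Fin (N + 1)) ℚ) x = x := by
    simp only [invariantRingQ, Algebra.mem_inf, Subalgebra.mem_restrictScalars, Algebra.mem_iInf,
      AlgHom.mem_equalizer, AlgHom.id_apply]
    rfl
  rw [h, actQ_invariant_iff N d hd0]
  simp only [craigEmbedding_eq]
  constructor
  · rintro ⟨⟨f, rfl⟩, hf⟩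
    exact ⟨f, rfl, hf⟩
  · rintro ⟨f, rfl, hf⟩
    exact ⟨⟨f, rfl⟩, hf⟩

theorem C_mem_range_craigEmbedding {r : ℚ} (hr : r ∈ R) : C r ∈ (craigEmbedding N d R).range :=
  ⟨C ⟨r, hr⟩, by
    change craigEmbedding N d R _ = _
    rw [craigEmbedding_eq, map_C, algHom_C, algebraMap_eq]; rfl⟩

theorem craigForm_mem_range (i : Fin (N + 1)) : craigForm N d i ∈ (craigEmbedding N d R).range :=
  ⟨X i, craigEmbedding_X N d R i⟩

theorem simpleRoot_mem_range (hd0 : 0 < d) (a : Fin (N + 1)) :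
    simpleRoot a ∈ (craigEmbedding N d R).range := by
  rw [← craigBasisMatrix_mulVec_craigForm N d hd0]
  change ∑ b, C (craigBasisMatrix N d a b) * craigForm N d b ∈ _
  refine Subalgebra.sum_mem _ fun b _ => mul_mem (C_mem_range_craigEmbedding N d R ?_)
    (craigForm_mem_range N d R b)
  rw [craigBasisMatrix_apply]
  split_ifs
  · exact natCast_mem R d
  · exact R.sub_mem (R.add_mem (natCast_mem R N) R.one_mem) (natCast_mem R b)
  · exact R.one_mem
  · exact R.zero_mem

theorem X_sub_X_mem_range (hd0 : 0 < d) (i j : Fin (N + 2)) :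
    (X i - X j : MvPolynomial (Fin (N + 2)) ℚ) ∈ (craigEmbedding N d R).range := by
  have h : ∀ i : Fin (N + 2),
      (X 0 - X i : MvPolynomial (Fin (N + 2)) ℚ) ∈ (craigEmbedding N d R).range := fun i => by
    induction i using Fin.induction with
    | zero => rw [sub_self]; exact zero_mem _
    | succ i ih => simpa [simpleRoot] using add_mem ih (simpleRoot_mem_range N d R hd0 i)
  simpa using sub_mem (h j) (h i)

variable {d}

theorem rename_craigForm_zero {e : ℕ} (he : N + 2 = d * e) (s : Equiv.Perm (Fin (N + 2))) :
    rename s (craigForm N d 0) = craigForm N d 0 + (C (e : ℚ) : MvPolynomial (Fin (N + 2)) ℚ) * (X 1 - X (s 1)) := by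
  have hd : (d : ℚ) ≠ 0 := by
    rintro h
    rw [Nat.cast_eq_zero.1 h] at he
    omega
  have hN : ((N : ℚ) + 2) = d * e := by exact_mod_cast he
  have hC : (C (e : ℚ) : MvPolynomial (Fin (N + 2)) ℚ) = C (1 / d : ℚ) * C ((N : ℚ) + 2) := by
    rw [← C_mul, hN]
    congr 1
    field_simp
  rw [craigForm_zero, hC]
  simp only [map_mul, map_sub, map_sum, algHom_C, algebraMap_eq, rename_X,
    Equiv.sum_comp s (fun j => (X j : MvPolynomial (Fin (N + 2)) ℚ))]
  ring

theorem rename_craigEmbedding_mem_range {e : ℕ} (he : N + 2 = d * e)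
    (s : Equiv.Perm (Fin (N + 2))) (f : MvPolynomial (Fin (N + 1)) R) :
    rename s (craigEmbedding N d R f) ∈ (craigEmbedding N d R).range := by
  have hd0 : 0 < d := Nat.pos_of_ne_zero (by rintro rfl; omega)
  induction f using MvPolynomial.induction_on with
  | C r =>
    rw [craigEmbedding_eq, map_C, algHom_C, algebraMap_eq, rename_C]
    exact C_mem_range_craigEmbedding N d R r.2
  | add f g hf hg => rw [map_add, map_add]; exact add_mem hf hg
  | mul_X f i hf =>
    rw [map_mul, map_mul, craigEmbedding_X]
    refine mul_mem hf ?_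
    refine Fin.cases ?_ (fun i => ?_) i
    · rw [rename_craigForm_zero N he]
      exact add_mem (craigForm_mem_range N d R 0) (mul_mem
        (C_mem_range_craigEmbedding N d R (natCast_mem R e)) (X_sub_X_mem_range N d R hd0 _ _))
    · rw [craigForm_succ, simpleRoot, map_sub, rename_X, rename_X]
      exact X_sub_X_mem_range N d R hd0 _ _

theorem linCoeff_craigForm_zero (l : Fin (N + 2)) :
    linCoeff l (craigForm N d 0) = 1 / d * (1 - ((N : ℚ) + 2) * if 1 = l then 1 else 0) := by
  rw [craigForm_zero, linCoeff_C_mul, map_sub, linCoeff_C_mul, map_sum]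
  simp [linCoeff_X]

theorem linCoeff_craigForm_succ (a : Fin N) (l : Fin (N + 2)) :
    linCoeff l (craigForm N d a.succ) =
      (if a.succ.castSucc = l then 1 else 0) - if a.succ.succ = l then 1 else 0 := by
  rw [craigForm_succ, simpleRoot, map_sub, linCoeff_X, linCoeff_X]

theorem linCoeff_craigEmbedding (l : Fin (N + 2)) (f : MvPolynomial (Fin (N + 1)) R) :
    linCoeff l (craigEmbedding N d R f) =
      ∑ i, ((linCoeff i f : R) : ℚ) * linCoeff l (craigForm N d i) := by
  refine linCoeff_aeval _ (fun i => ?_) l f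
  refine Fin.cases ?_ (fun i => ?_) i
  · simp [craigForm_zero]
  · simp [craigForm_succ, simpleRoot]

theorem linCoeff_sub_linCoeff_mem {e : ℕ} (he : N + 2 = d * e) (l l' : Fin (N + 2))
    (f : MvPolynomial (Fin (N + 1)) R) :
    linCoeff l (craigEmbedding N d R f) - linCoeff l' (craigEmbedding N d R f) ∈ R := by
  have hd : (d : ℚ) ≠ 0 := by
    rintro h
    rw [Nat.cast_eq_zero.1 h] at he
    omega
  have hN : ((N : ℚ) + 2) = d * e := by exact_mod_cast he
  have hite : ∀ (P : Prop) [Decidable P], (if P then (1 : ℚ) else 0) ∈ R := fun P _ => by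
    split_ifs
    exacts [R.one_mem, R.zero_mem]
  rw [linCoeff_craigEmbedding, linCoeff_craigEmbedding, ← Finset.sum_sub_distrib]
  refine R.sum_mem fun i _ => ?_
  rw [← mul_sub]
  refine R.mul_mem (linCoeff i f).2 ?_
  refine Fin.cases ?_ (fun i => ?_) i
  · rw [linCoeff_craigForm_zero, linCoeff_craigForm_zero, hN]
    have : (1 / d * (1 - (d * e : ℚ) * if 1 = l then 1 else 0) -
        1 / d * (1 - (d * e : ℚ) * if 1 = l' then 1 else 0)) =
          e * ((if 1 = l' then 1 else 0) - (if 1 = l then 1 else 0)) := by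
      field_simp
      ring
    rw [this]
    exact R.mul_mem (natCast_mem R e) (R.sub_mem (hite _) (hite _))
  · rw [linCoeff_craigForm_succ, linCoeff_craigForm_succ]
    exact R.sub_mem (R.sub_mem (hite _) (hite _)) (R.sub_mem (hite _) (hite _))

theorem linCoeff_zero_eq_zero_of_invariant (hd0 : 0 < d) (f : MvPolynomial (Fin (N + 1)) R)
    (hf : ∀ s : Equiv.Perm (Fin (N + 2)),
      rename s (craigEmbedding N d R f) = craigEmbedding N d R f) :
    linCoeff 0 f = 0 := by
  have hconst : ∀ l, linCoeff l (craigEmbedding N d R f) =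
      linCoeff 0 (craigEmbedding N d R f) := fun l => by
    have h := linCoeff_rename (Equiv.swap 0 l) 0 (craigEmbedding N d R f)
    rwa [hf, Equiv.swap_apply_left] at h
  have hsum : ∑ l, linCoeff l (craigEmbedding N d R f) = 0 := by
    simp only [linCoeff_craigEmbedding]
    rw [Finset.sum_comm]
    refine Finset.sum_eq_zero fun i _ => ?_
    rw [← Finset.mul_sum]
    refine mul_eq_zero_of_right _ ?_
    refine Fin.cases ?_ (fun i => ?_) i
    · simp only [linCoeff_craigForm_zero, ← Finset.mul_sum, Finset.sum_sub_distrib]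
      simp
    · simp [linCoeff_craigForm_succ]
  have h0 : linCoeff 0 (craigEmbedding N d R f) = 0 := by
    rw [Finset.sum_congr rfl fun l _ => hconst l, Finset.sum_const, nsmul_eq_mul,
      mul_eq_zero] at hsum
    exact hsum.resolve_left (by simp; positivity)
  rw [linCoeff_craigEmbedding, Fin.sum_univ_succ, linCoeff_craigForm_zero,
    Finset.sum_eq_zero fun i _ => by
      rw [linCoeff_craigForm_succ, if_neg (by simp [Fin.ext_iff]), if_neg (by simp [Fin.ext_iff])]
      simp] at h0
  have hd : (d : ℚ) ≠ 0 := by exact_mod_cast hd0.ne'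
  have h10 : (1 : Fin (N + 2)) ≠ 0 := by simp
  rw [if_neg h10] at h0
  apply Subtype.ext
  simpa [hd] using h0

theorem Fin.exists_notMem_of_card_lt {n : ℕ} (S : Finset (Fin n)) (h : S.card < n) :
    ∃ x, x ∉ S := by
  by_contra! hcon
  rw [(Finset.eq_univ_iff_forall.2 hcon), Finset.card_univ, Fintype.card_fin] at h
  exact lt_irrefl _ h

/-- The symmetric group acts faithfully on the roots modulo any noninvertible integer. -/
theorem eq_one_of_rename_congr {e p : ℕ} (he : N + 2 = d * e) (hN : 3 ≤ N)
    (hpR : (p : ℚ)⁻¹ ∉ R) (s : Equiv.Perm (Fin (N + 2)))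
    (hs : ∀ i j, ∃ f, rename s (X i - X j : MvPolynomial (Fin (N + 2)) ℚ) - (X i - X j) =
      C (p : ℚ) * craigEmbedding N d R f) : s = 1 := by
  by_contra hne
  obtain ⟨j, hj⟩ : ∃ j, s j ≠ j := by
    by_contra! hcon
    exact hne (Equiv.ext hcon)
  obtain ⟨k, hk⟩ := Fin.exists_notMem_of_card_lt {j, s⁻¹ j}
    (Finset.card_le_two.trans_lt (by omega))
  obtain ⟨l, hl⟩ := Fin.exists_notMem_of_card_lt {j, k, s j, s k}
    (Finset.card_le_four.trans_lt (by omega))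
  simp only [Finset.mem_insert, Finset.mem_singleton, not_or] at hk hl
  have hsk : s k ≠ j := fun h => hk.2 (by rw [← h]; simp)
  obtain ⟨f, hf⟩ := hs j k
  have h1 := linCoeff_sub_linCoeff_mem N R he l j f
  have h2 : (p : ℚ) * (linCoeff l (craigEmbedding N d R f) -
      linCoeff j (craigEmbedding N d R f)) = 1 := by
    rw [mul_sub, ← linCoeff_C_mul, ← linCoeff_C_mul, ← hf]
    simp only [map_sub, rename_X, linCoeff_X]
    simp [hj, hsk, hk.1, Ne.symm hl.1, Ne.symm hl.2.1, Ne.symm hl.2.2.1, Ne.symm hl.2.2.2]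
  rw [← eq_inv_of_mul_eq_one_right h2] at hpR
  exact hpR h1

end Craig

/-- The invariant ring of Craig's group is root closed modulo `p` if it is a polynomial ring. -/
theorem exists_invariant_of_pow_eq {N d : ℕ} {R : Subring ℚ} (hd0 : 0 < d)
    (hpoly : IsPolynomialRingQ R (craigGroupSucc N d)) {p : ℕ}
    (hp : (Ideal.span {(p : R)}).IsMaximal) {a h n c : MvPolynomial (Fin (N + 1)) R}
    (ha : ∀ s : Equiv.Perm (Fin (N + 2)),
      rename s (craigEmbedding N d R a) = craigEmbedding N d R a)
    (hh : ∀ s : Equiv.Perm (Fin (N + 2)),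
      rename s (craigEmbedding N d R h) = craigEmbedding N d R h)
    (hn : ∀ s : Equiv.Perm (Fin (N + 2)),
      rename s (craigEmbedding N d R n) = craigEmbedding N d R n)
    (hc : ∀ s : Equiv.Perm (Fin (N + 2)),
      rename s (craigEmbedding N d R c) = craigEmbedding N d R c)
    {k : ℕ} (hk : k ≠ 0) (H : a ^ k = h ^ k * n + C (p : R) * c) :
    ∃ q, (∀ s : Equiv.Perm (Fin (N + 2)),
      rename s (craigEmbedding N d R q) = craigEmbedding N d R q) ∧
        C (p : R) ∣ a - h * q := by
  obtain ⟨K, ⟨Φ⟩⟩ := hpoly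
  have hlift : ∀ f : MvPolynomial (Fin (N + 1)) R, (∀ s : Equiv.Perm (Fin (N + 2)),
      rename s (craigEmbedding N d R f) = craigEmbedding N d R f) →
      ∃ x : invariantRingQ R (craigGroupSucc N d), (x : MvPolynomial _ ℚ) =
        map (algebraMap R ℚ) f := fun f hf =>
    ⟨⟨_, (mem_invariantRingQ_iff N d R hd0 _).2 ⟨f, rfl, hf⟩⟩, rfl⟩
  obtain ⟨a', ha'⟩ := hlift a ha
  obtain ⟨h', hh'⟩ := hlift h hh
  obtain ⟨n', hn'⟩ := hlift n hn
  obtain ⟨c', hc'⟩ := hlift c hc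
  have H' : a' ^ k = h' ^ k * n' + (p : invariantRingQ R (craigGroupSucc N d)) * c' := by
    apply Subtype.ext
    push_cast
    rw [ha', hh', hn', hc', ← map_pow, H]
    simp
  have H'' := congrArg Φ H'
  rw [map_add, map_mul, map_mul, map_pow, map_pow, map_natCast, ← map_natCast C] at H''
  obtain ⟨q, r, hqr⟩ := exists_eq_mul_add_of_pow_eq hp hk H''
  have hqr' : a' = h' * Φ.symm q + (p : invariantRingQ R (craigGroupSucc N d)) * Φ.symm r := by
    apply Φ.injective
    rw [hqr]
    simp
  obtain ⟨q₀, hq₀, hq₀inv⟩ := (mem_invariantRingQ_iff N d R hd0 _).1 (Φ.symm q).2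
  obtain ⟨r₀, hr₀, -⟩ := (mem_invariantRingQ_iff N d R hd0 _).1 (Φ.symm r).2
  refine ⟨q₀, hq₀inv, r₀, ?_⟩
  apply map_injective (algebraMap R ℚ) Subtype.val_injective
  have h1 := congrArg Subtype.val hqr'
  push_cast at h1
  rw [ha', hh', ← hq₀, ← hr₀] at h1
  rw [map_sub, h1]
  simp

/-- The action of the symmetric group on the polynomial functions on Craig's lattice. -/
theorem exists_action {N d e : ℕ} (R : Subring ℚ) (hd0 : 0 < d) (he : N + 2 = d * e) :
    ∃ τ : Equiv.Perm (Fin (N + 2)) →*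
        (MvPolynomial (Fin (N + 1)) R →+* MvPolynomial (Fin (N + 1)) R),
      ∀ s f, craigEmbedding N d R (τ s f) = rename s (craigEmbedding N d R f) := by
  have hinj := craigEmbedding_injective N d R hd0
  choose T hT using fun s f => rename_craigEmbedding_mem_range N R he s f
  have hT' : ∀ s f, craigEmbedding N d R (T s f) = rename s (craigEmbedding N d R f) := hT
  refine ⟨⟨⟨fun s => ⟨⟨⟨T s, ?_⟩, ?_⟩, ?_, ?_⟩, ?_⟩, ?_⟩, fun s f => hT' s f⟩
  · apply hinj; simp [hT']
  · intro f g; apply hinj; simp [hT']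
  · apply hinj; simp [hT']
  · intro f g; apply hinj; simp [hT']
  · apply RingHom.ext
    intro f
    apply hinj
    change craigEmbedding N d R (T 1 f) = craigEmbedding N d R f
    rw [hT', Equiv.Perm.coe_one, rename_id_apply]
  · intro s t
    apply RingHom.ext
    intro f
    apply hinj
    change craigEmbedding N d R (T (s * t) f) = craigEmbedding N d R (T s (T t f))
    rw [hT', hT', hT', rename_rename]
    rfl

/-- let `n ≥ 5`, let `d > 0` divide `n`, and let `L_d` be Craig's integral
representation of `S_n` of rank `n-1`. If `R` is a ring with `ℤ ⊆ R ⊆ ℚ` such that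
`R[L_d]^{S_n}` is isomorphic to a polynomial ring over `R`, then `d/n ∈ R`. -/
theorem craig_invariants_polynomial_imp_mem (n d : ℕ) (hn : 5 ≤ n) (hd : d ∣ n) (hd0 : 0 < d)
    (R : Subring ℚ) (hpoly : IsPolynomialRingQ R (craigGroup n d)) :
    (d : ℚ) / (n : ℚ) ∈ R := by
  obtain ⟨N, rfl⟩ : ∃ N, n = N + 2 := ⟨n - 2, by omega⟩
  obtain ⟨e, he⟩ := hd
  have he0 : e ≠ 0 := by rintro rfl; omega
  have hdq : (d : ℚ) ≠ 0 := by exact_mod_cast hd0.ne'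
  by_contra hcon
  have heR : (e : ℚ)⁻¹ ∉ R := fun h => hcon (by
    rw [he, Nat.cast_mul, div_mul_cancel_left₀ hdq]; exact h)
  obtain ⟨p, hp, ⟨e', he'⟩, hpR⟩ := R.exists_prime_dvd_inv_notMem he0 heR
  have hmax := R.isMaximal_span_natCast hp hpR
  have hpR0 : (p : R) ≠ 0 := by exact_mod_cast hp.ne_zero
  have hprime : Prime (C (p : R) : MvPolynomial (Fin (N + 1)) R) :=
    (prime_C_iff _).2 ((Ideal.span_singleton_prime hpR0).1 hmax.isPrime)
  have hinj := craigEmbedding_injective N d R hd0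
  obtain ⟨τ, hτ⟩ := exists_action R hd0 he
  have hinv : ∀ f, (∀ s, τ s f = f) ↔ ∀ s : Equiv.Perm (Fin (N + 2)),
      rename s (craigEmbedding N d R f) = craigEmbedding N d R f := fun f => by
    simp only [← hτ, hinj.eq_iff]
  have hCp : craigEmbedding N d R (C (p : R)) = C (p : ℚ) := by simp
  obtain ⟨q, hq, b, hb⟩ := exists_invariant_sub_dvd τ hprime (t := X 0)
    (fun s => by rw [map_natCast C, map_natCast])
    (fun s hs => eq_one_of_rename_congr N R he (by omega) hpR s fun i j => by
      obtain ⟨f, hf⟩ := X_sub_X_mem_range N d R hd0 i j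
      have hf : craigEmbedding N d R f = X i - X j := hf
      obtain ⟨g, hg⟩ := hs f
      refine ⟨g, ?_⟩
      rw [← hf, ← hτ, ← map_sub, hg, map_mul, hCp])
    (fun a h m c ha hh hm hc k hk H => by
      obtain ⟨q, hq, hdvd⟩ := exists_invariant_of_pow_eq hd0 hpoly hmax ((hinv a).1 ha)
        ((hinv h).1 hh) ((hinv m).1 hm) ((hinv c).1 hc) hk H
      exact ⟨q, (hinv q).2 hq, hdvd⟩)
    (fun s => by
      obtain ⟨f, hf⟩ := X_sub_X_mem_range N d R hd0 1 (s 1)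
      have hf : craigEmbedding N d R f = X 1 - X (s 1) := hf
      refine ⟨C (e' : R) * f, ?_⟩
      apply hinj
      rw [map_sub, hτ, craigEmbedding_X, rename_craigForm_zero N he, ← hf, he']
      simp [mul_assoc])
  have h0 := linCoeff_zero_eq_zero_of_invariant N R hd0 q ((hinv q).1 hq)
  rw [sub_eq_iff_eq_add.1 hb, map_add, linCoeff_C_mul, linCoeff_X, if_pos rfl] at h0
  refine hmax.ne_top ((Ideal.eq_top_iff_one _).2 (Ideal.mem_span_singleton.2
    ⟨-linCoeff 0 b, ?_⟩))
  linear_combination h0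
end
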